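/- arXiv:1605.08731 — 2 statements merged into one kernel-verified Lean document; each statement's English description precedes it below -/
import Mathlib

section
/- Let X ⊂ int(𝔸) be an f-invariant essential annular continuum and let m ≥ 1 be an integer such that (f̃^m(x))₁ ≥ (x)₁ + 1 for every x ∈ X̃. Then there exists M > 1 such that for every point x ∈ V the following holds: if every hair γ of V with γ(1) = x satisfies diam((γ)₁) > M, then (f̃^m(x))₁ ≥ (x)₁ + 1/2. -/
open Set Function MeasureTheory Filter Topology

noncomputable section

/-- The vertical fiber `[-1,1]`. -/
abbrev II : Set ℝ := Set.Icc (-1 : ℝ) 1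

/-- The universal cover `ℝ × [-1,1]` of the annulus. -/
abbrev Strip : Type := ℝ × II

/-- The compact annulus `(ℝ/ℤ) × [-1,1]`. -/
abbrev Ann : Type := AddCircle (1 : ℝ) × II

/-- The covering projection `π`. -/
def pr (z : Strip) : Ann := ((z.1 : AddCircle (1 : ℝ)), z.2)

/-- The deck transformation `T^k`. -/
def shiftPt (k : ℤ) (z : Strip) : Strip := (z.1 + k, z.2)

/-- `S + k`, the image of `S` under `T^k`. -/
def shiftSet (k : ℤ) (S : Set Strip) : Set Strip := shiftPt k '' S

/-- `f` is isotopic to the identity. -/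
def IsotopicToId (f : Ann → Ann) : Prop :=
  ∃ H : ℝ → Ann → Ann, Continuous (fun p : ℝ × Ann => H p.1 p.2) ∧
    (∀ t : ℝ, Function.Bijective (H t)) ∧ H 0 = id ∧ H 1 = f

/-- `F` is a lift of `f` commuting with the deck transformation. -/
def IsLift (f : Ann → Ann) (F : Strip → Strip) : Prop :=
  (∀ z, pr (F z) = f (pr z)) ∧ (∀ z, F (shiftPt 1 z) = shiftPt 1 (F z))

/-- `X` is an essential annular continuum with complementary components `Um`, `Up`. -/
structure IsEAC (X Um Up : Set Ann) : Prop where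
  compact : IsCompact X
  connected : IsConnected X
  inInterior : ∀ p ∈ X, ((p.2 : ℝ)) ∈ Set.Ioo (-1 : ℝ) 1
  hUm : Um = connectedComponentIn Xᶜ ((0 : AddCircle (1 : ℝ)), ⟨-1, le_rfl, by norm_num⟩)
  hUp : Up = connectedComponentIn Xᶜ ((0 : AddCircle (1 : ℝ)), ⟨1, by norm_num, le_rfl⟩)
  cover : Xᶜ = Um ∪ Up
  ne : Um ≠ Up

/-- An arc `γ : [0,1] → U ∪ {p}` with `γ([0,1)) ⊂ U` and `γ(1) = p`. -/
def IsArcTo (U : Set Strip) (γ : unitInterval → Strip) (p : Strip) : Prop :=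
  Continuous γ ∧ Function.Injective γ ∧ (∀ t, t ≠ 1 → γ t ∈ U) ∧ γ 1 = p

/-- `p` is accessible from `U`. -/
def AccFrom (U : Set Strip) (p : Strip) : Prop := ∃ γ, IsArcTo U γ p

/-- The order `≺` on accessible points, with access arcs starting on `ℝ × {b}`. -/
def PrecB (b : ℝ) (U : Set Strip) (x x' : Strip) : Prop :=
  ∃ γ γ' : unitInterval → Strip,
    IsArcTo U γ x ∧ IsArcTo U γ' x' ∧
    ((γ 0).2 : ℝ) = b ∧ ((γ' 0).2 : ℝ) = b ∧
    Disjoint (range γ) (range γ') ∧ (γ 0).1 < (γ' 0).1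

/-- `k = k(x,y)` is the unique integer with `T^k(y) ⪯ x ≺ T^{k+1}(y)`. -/
def AccIdxB (b : ℝ) (U : Set Strip) (x y : Strip) (k : ℤ) : Prop :=
  (shiftPt k y = x ∨ PrecB b U (shiftPt k y) x) ∧ PrecB b U x (shiftPt (k + 1) y)

/-- `ρ` is the prime end rotation number of the lift `F` as seen from `U`
(access arcs starting at height `b`): `k(Fⁿ(x), y)/n → ρ` for all accessible `x, y`. -/
def PrimeEndRotB (b : ℝ) (U Xt : Set Strip) (F : Strip → Strip) (ρ : ℝ) : Prop :=
  ∀ x ∈ Xt, ∀ y ∈ Xt, AccFrom U x → AccFrom U y →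
    ∀ k : ℕ → ℤ, (∀ n : ℕ, AccIdxB b U (F^[n] x) y (k n)) →
      Tendsto (fun n : ℕ => (k n : ℝ) / (n : ℝ)) atTop (𝓝 ρ)

/-- The measure-theoretic rotation set `ρ_mes(g̃, X)`, where `φ` is the displacement
function of the lift `g̃` (pushed down to the annulus). -/
def rotMes (g : Ann → Ann) (φ : Ann → ℝ) (X : Set Ann) : Set ℝ :=
  {r | ∃ μ : Measure Ann, IsProbabilityMeasure μ ∧ Measure.map g μ = μ ∧
    μ Xᶜ = 0 ∧ ∫ a, φ a ∂μ = r}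

/-- A point in the interior of the top boundary segment `(0,1) × {1}`. -/
def topSeg : Strip := ((1 : ℝ) / 2, ⟨1, by norm_num, le_rfl⟩)

/-- `β' = β ∖ {x₀} = {0} × (η, 1]`. -/
def betaP (η : ℝ) : Set Strip := {z : Strip | z.1 = 0 ∧ η < (z.2 : ℝ)}

/-- `η = max{y : (0,y) ∈ X̃}`. -/
def etaSpec (Xt : Set Strip) (η : ℝ) : Prop :=
  IsGreatest {y : ℝ | ∃ z ∈ Xt, z.1 = 0 ∧ (z.2 : ℝ) = y} η

/-- The fundamental region `V`: the closure, relative to `Ũ₊`, of the connected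
component of `Ũ₊ ∖ (β' ∪ (β' + 1))` containing the segment `(0,1) × {1}`. -/
def Vset (Utp : Set Strip) (η : ℝ) : Set Strip :=
  Utp ∩ closure (connectedComponentIn (Utp \ (betaP η ∪ shiftSet 1 (betaP η))) topSeg)

/-- A hair of `W`: an arc in `W` starting on `ℝ × {1}`. -/
def IsHair (W : Set Strip) (γ : unitInterval → Strip) : Prop :=
  Continuous γ ∧ Function.Injective γ ∧ ((γ 0).2 : ℝ) = 1 ∧ ∀ t, γ t ∈ W

/-- `(γ)₁`, the projection of the image of `γ` to the first coordinate. -/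
def proj1 (γ : unitInterval → Strip) : Set ℝ := range fun t => (γ t).1

/-- `(V + k)⁻ = ⋃_{j ≤ k} (V + j)`. -/
def VMinus (k : ℤ) (V : Set Strip) : Set Strip := ⋃ j ∈ Iic k, shiftSet j V

/-- `(V + k)⁺ = ⋃_{j ≥ k} (V + j)`. -/
def VPlus (k : ℤ) (V : Set Strip) : Set Strip := ⋃ j ∈ Ici k, shiftSet j V

/-- A crosscut of `Ũ₊`: an arc with endpoints on `X̃` and interior in `Ũ₊`. -/
def IsCrosscut (Utp Xt : Set Strip) (c : unitInterval → Strip) : Prop :=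
  Continuous c ∧ Function.Injective c ∧ c 0 ∈ Xt ∧ c 1 ∈ Xt ∧
    ∀ t, t ≠ 0 → t ≠ 1 → c t ∈ Utp

/-- `F^n` for `n : ℤ`. -/
def iterZ (F : Strip ≃ₜ Strip) (n : ℤ) : Strip → Strip := fun z => (F.toEquiv ^ n) z

end

/-- The straight segment from `p` to `q` in the strip. -/
def sgm (p q : Strip) (t : unitInterval) : Strip :=
  ((1 - (t : ℝ)) * p.1 + t * q.1, ⟨(1 - (t : ℝ)) * p.2 + t * q.2, by
    have h1 := t.2.1
    have h2 := t.2.2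
    have h3 := p.2.2.1
    have h4 := p.2.2.2
    have h5 := q.2.2.1
    have h6 := q.2.2.2
    constructor <;> nlinarith⟩)

lemma sgm_cont (p q : Strip) : Continuous (sgm p q) := by
  unfold sgm
  fun_prop

lemma sgm_zero (p q : Strip) : sgm p q 0 = p := by
  ext <;> simp [sgm]

lemma sgm_one (p q : Strip) : sgm p q 1 = q := by
  ext <;> simp [sgm]

lemma sgm_inj {p q : Strip} (h : p ≠ q) : Function.Injective (sgm p q) := by
  intro s t hst
  have h1 : (1 - (s : ℝ)) * p.1 + s * q.1 = (1 - (t : ℝ)) * p.1 + t * q.1 :=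
    congrArg Prod.fst hst
  have h2 : (1 - (s : ℝ)) * p.2 + s * q.2 = (1 - (t : ℝ)) * p.2 + t * q.2 :=
    congrArg (fun z : Strip => (z.2 : ℝ)) hst
  by_contra hne
  have hne' : (s : ℝ) - t ≠ 0 := fun h0 => hne (Subtype.ext (by linarith))
  apply h
  have e1 : p.1 = q.1 := by
    have : ((s : ℝ) - t) * (p.1 - q.1) = 0 := by linarith
    rcases mul_eq_zero.1 this with h0 | h0
    · exact absurd h0 hne'
    · linarith
  have e2 : (p.2 : ℝ) = q.2 := by
    have : ((s : ℝ) - t) * ((p.2 : ℝ) - q.2) = 0 := by linarith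
    rcases mul_eq_zero.1 this with h0 | h0
    · exact absurd h0 hne'
    · linarith
  exact Prod.ext e1 (Subtype.ext e2)

/-- Sets stable under straight segments. -/
def SConv (B : Set Strip) : Prop := ∀ p ∈ B, ∀ q ∈ B, ∀ t, sgm p q t ∈ B

/-- Points whose coordinates lie in the given sets. -/
def rct (I J : Set ℝ) : Set Strip := {z | z.1 ∈ I ∧ (z.2 : ℝ) ∈ J}

lemma rct_sconv {I J : Set ℝ} (hI : Convex ℝ I) (hJ : Convex ℝ J) : SConv (rct I J) := by
  intro p hp q hq t
  have h1 := t.2.1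
  have h2 := t.2.2
  constructor
  · have := hI hp.1 hq.1 (sub_nonneg.2 h2) h1 (by ring)
    simpa [sgm] using this
  · have := hJ hp.2 hq.2 (sub_nonneg.2 h2) h1 (by ring)
    simpa [sgm] using this

lemma rct_open {I J : Set ℝ} (hI : IsOpen I) (hJ : IsOpen J) : IsOpen (rct I J) :=
  (hI.preimage continuous_fst).inter (hJ.preimage (continuous_subtype_val.comp continuous_snd))

lemma rct_closed {I J : Set ℝ} (hI : IsClosed I) (hJ : IsClosed J) : IsClosed (rct I J) :=
  (hI.preimage continuous_fst).inter (hJ.preimage (continuous_subtype_val.comp continuous_snd))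

lemma SConv.isPathConnected {B : Set Strip} (hB : SConv B) {p : Strip} (hp : p ∈ B) :
    IsPathConnected B := by
  refine ⟨p, hp, fun {q} hq => ?_⟩
  exact ⟨⟨⟨sgm p q, sgm_cont p q⟩, sgm_zero p q, sgm_one p q⟩, fun t => hB p hp q hq t⟩

lemma ball_eq_rct (p : Strip) (r : ℝ) :
    Metric.ball p r = rct (Ioo (p.1 - r) (p.1 + r)) (Ioo ((p.2 : ℝ) - r) (p.2 + r)) := by
  ext z
  simp only [Metric.mem_ball, rct, mem_ofPred_eq, Prod.dist_eq, max_lt_iff, Subtype.dist_eq,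
    Real.dist_eq, abs_lt, mem_Ioo]
  constructor <;> rintro ⟨⟨_, _⟩, _, _⟩ <;> refine ⟨⟨?_, ?_⟩, ?_, ?_⟩ <;> linarith

lemma closedBall_eq_rct (p : Strip) (r : ℝ) :
    Metric.closedBall p r = rct (Icc (p.1 - r) (p.1 + r)) (Icc ((p.2 : ℝ) - r) (p.2 + r)) := by
  ext z
  simp only [Metric.mem_closedBall, rct, mem_ofPred_eq, Prod.dist_eq, max_le_iff, Subtype.dist_eq,
    Real.dist_eq, abs_le, mem_Icc]
  constructor <;> rintro ⟨⟨_, _⟩, _, _⟩ <;> refine ⟨⟨?_, ?_⟩, ?_, ?_⟩ <;> linarith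

lemma strip_lpc : LocallyPathConnectedSpace Strip := by
  refine LocallyPathConnectedSpace.of_bases (fun x => Metric.nhds_basis_ball) ?_
  intro x r hr
  rw [ball_eq_rct]
  refine (rct_sconv (convex_Ioo _ _) (convex_Ioo _ _)).isPathConnected (p := x) ?_
  rw [← ball_eq_rct]
  exact Metric.mem_ball_self hr

/-- The key extension lemma for hairs. -/
lemma hair_extend {W B : Set Strip} {γ : unitInterval → Strip} (hγ : IsHair W γ)
    (hBW : B ⊆ W) (hBc : IsClosed B) (hB : SConv B)
    (htop : ∀ q ∈ B, (q.2 : ℝ) = 1 → ∃ p ∈ B, (p.2 : ℝ) = 1 ∧ p ≠ q)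
    (h1 : γ 1 ∈ B) {q : Strip} (hq : q ∈ B) :
    ∃ γ', IsHair W γ' ∧ γ' 1 = q ∧ range γ' ⊆ range γ ∪ B := by
  obtain ⟨hc, hi, h0, hW⟩ := hγ
  have segcase : ∀ p ∈ B, (p.2 : ℝ) = 1 → p ≠ q →
      ∃ γ', IsHair W γ' ∧ γ' 1 = q ∧ range γ' ⊆ range γ ∪ B := by
    intro p hp hp1 hpq
    refine ⟨sgm p q, ⟨sgm_cont p q, sgm_inj hpq, ?_, fun t => hBW (hB p hp q hq t)⟩,
      sgm_one p q, ?_⟩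
    · rw [sgm_zero]; exact hp1
    · rintro _ ⟨t, rfl⟩; exact Or.inr (hB p hp q hq t)
  have hTc : IsCompact (γ ⁻¹' B) := (hBc.preimage hc).isCompact
  obtain ⟨t0, ht0, hmin⟩ := hTc.exists_isLeast ⟨1, h1⟩
  by_cases hz : t0 = 0
  · subst hz
    by_cases hpq : γ 0 = q
    · obtain ⟨p, hp, hp1, hpq'⟩ := htop q hq (hpq ▸ h0)
      exact segcase p hp hp1 hpq'
    · exact segcase _ ht0 h0 hpq
  have ht0pos : (0 : ℝ) < t0 := lt_of_le_of_ne t0.2.1 (fun h => hz (Subtype.ext h.symm))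
  by_cases hpq : γ t0 = q
  · refine ⟨fun s => γ (s * t0), ⟨by fun_prop, ?_, ?_, fun t => hW _⟩, ?_, ?_⟩
    · intro s s' hs
      have := congrArg (Subtype.val) (hi hs)
      simp only [Set.Icc.coe_mul] at this
      exact Subtype.ext (mul_right_cancel₀ ht0pos.ne' this)
    · simpa using h0
    · simpa using hpq
    · rintro _ ⟨t, rfl⟩; exact Or.inl ⟨_, rfl⟩
  -- main case
  set p := γ t0 with hp
  let a : unitInterval → unitInterval := fun s => projIcc 0 1 zero_le_one (2 * (s : ℝ))
  let b : unitInterval → unitInterval := fun s => projIcc 0 1 zero_le_one (2 * (s : ℝ) - 1)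
  have ha : Continuous a := continuous_projIcc.comp (by fun_prop)
  have hb : Continuous b := continuous_projIcc.comp (by fun_prop)
  have ha' : ∀ s : unitInterval, (s : ℝ) ≤ 1 / 2 → (a s : ℝ) = 2 * s := by
    intro s hs
    have := s.2.1
    simp only [a]
    rw [projIcc_of_mem zero_le_one (⟨by linarith, by linarith⟩ : 2 * (s : ℝ) ∈ Icc (0 : ℝ) 1)]
  have hb' : ∀ s : unitInterval, 1 / 2 ≤ (s : ℝ) → (b s : ℝ) = 2 * s - 1 := by
    intro s hs
    have := s.2.2
    simp only [b]
    rw [projIcc_of_mem zero_le_one (⟨by linarith, by linarith⟩ : 2 * (s : ℝ) - 1 ∈ Icc (0 : ℝ) 1)]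
  let δ : unitInterval → Strip := fun s =>
    if (s : ℝ) ≤ 1 / 2 then γ (a s * t0) else sgm p q (b s)
  have d1 : ∀ s : unitInterval, (s : ℝ) ≤ 1 / 2 → δ s = γ (a s * t0) := fun s hs => if_pos hs
  have d2 : ∀ s : unitInterval, ¬ (s : ℝ) ≤ 1 / 2 → δ s = sgm p q (b s) := fun s hs => if_neg hs
  have hpB : p ∈ B := ht0
  have hmix : ∀ s s' : unitInterval, (s : ℝ) ≤ 1 / 2 → ¬ (s' : ℝ) ≤ 1 / 2 → δ s ≠ δ s' := by
    intro s s' hs hs' heq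
    rw [d1 s hs, d2 s' hs'] at heq
    have hm : a s * t0 ∈ γ ⁻¹' B := by
      show γ _ ∈ B
      rw [heq]; exact hB p hpB q hq _
    have hle : (t0 : ℝ) ≤ a s * t0 := hmin hm
    have hle2 : a s * t0 = t0 := by
      apply Subtype.ext
      apply le_antisymm
      · have := (a s).2.2
        simp only [Set.Icc.coe_mul]
        nlinarith
      · simpa using hle
    rw [hle2, ← hp] at heq
    have : sgm p q 0 = sgm p q (b s') := by rw [sgm_zero]; exact heq
    have := congrArg Subtype.val (sgm_inj hpq this)
    rw [hb' s' (by linarith)] at this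
    simp at this
    push Not at hs'
    linarith
  refine ⟨δ, ⟨?_, ?_, ?_, ?_⟩, ?_, ?_⟩
  · refine Continuous.if_le (by fun_prop) ((sgm_cont p q).comp hb) (by fun_prop) (by fun_prop) ?_
    intro s hs
    have e1 : a s = 1 := Subtype.ext (by rw [ha' s hs.le, hs]; norm_num)
    have e2 : b s = 0 := Subtype.ext (by rw [hb' s hs.ge, hs]; norm_num)
    rw [e1, e2, sgm_zero, one_mul]
  · intro s s' heq
    by_cases hs : (s : ℝ) ≤ 1 / 2 <;> by_cases hs' : (s' : ℝ) ≤ 1 / 2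
    · rw [d1 s hs, d1 s' hs'] at heq
      have := congrArg (Subtype.val) (hi heq)
      simp only [Set.Icc.coe_mul] at this
      have := mul_right_cancel₀ ht0pos.ne' this
      rw [ha' s hs, ha' s' hs'] at this
      exact Subtype.ext (by linarith)
    · exact absurd heq (hmix s s' hs hs')
    · exact absurd heq.symm (hmix s' s hs' hs)
    · rw [d2 s hs, d2 s' hs'] at heq
      have := congrArg (Subtype.val) (sgm_inj hpq heq)
      push Not at hs hs'
      rw [hb' s hs.le, hb' s' hs'.le] at this
      exact Subtype.ext (by linarith)
  · have e1 : a 0 = 0 := Subtype.ext (by rw [ha' 0 (by simp)]; simp)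
    rw [d1 0 (by simp), e1, zero_mul]; exact h0
  · intro s
    by_cases hs : (s : ℝ) ≤ 1 / 2
    · rw [d1 s hs]; exact hW _
    · rw [d2 s hs]; exact hBW (hB p hpB q hq _)
  · have e1 : b 1 = 1 := Subtype.ext (by rw [hb' 1 (by norm_num)]; norm_num)
    rw [d2 1 (by norm_num), e1, sgm_one]
  · rintro _ ⟨s, rfl⟩
    by_cases hs : (s : ℝ) ≤ 1 / 2
    · rw [d1 s hs]; exact Or.inl ⟨_, rfl⟩
    · rw [d2 s hs]; exact Or.inr (hB p hpB q hq _)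

lemma rct_top {I J : Set ℝ} {a b : ℝ} (ha : a ∈ I) (hb : b ∈ I) (hab : a ≠ b) :
    ∀ q ∈ rct I J, (q.2 : ℝ) = 1 → ∃ p ∈ rct I J, (p.2 : ℝ) = 1 ∧ p ≠ q := by
  intro q hq h1
  by_cases h : a = q.1
  · exact ⟨(b, q.2), ⟨hb, hq.2⟩, h1, fun h' => hab (h.trans (congrArg Prod.fst h').symm)⟩
  · exact ⟨(a, q.2), ⟨ha, hq.2⟩, h1, fun heq => h (congrArg Prod.fst heq)⟩

/-- Every point of an open connected set touching the top is the end of a hair. -/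
lemma hair_exists {O : Set Strip} (hO : IsOpen O) (hconn : IsPreconnected O)
    {p0 : Strip} (hp0 : p0 ∈ O) (htop : (p0.2 : ℝ) = 1) :
    ∀ q ∈ O, ∃ γ, IsHair O γ ∧ γ 1 = q := by
  have key : ∀ x ∈ O, ∃ r > 0, Metric.closedBall x r ⊆ O := fun x hx =>
    Metric.nhds_basis_closedBall.mem_iff.1 (hO.mem_nhds hx)
  have hsc : ∀ (x : Strip) r, SConv (Metric.closedBall x r) := by
    intro x r
    rw [closedBall_eq_rct]
    exact rct_sconv (convex_Icc _ _) (convex_Icc _ _)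
  have htp : ∀ (x : Strip) r, 0 < r → ∀ q ∈ Metric.closedBall x r, (q.2 : ℝ) = 1 →
      ∃ p ∈ Metric.closedBall x r, (p.2 : ℝ) = 1 ∧ p ≠ q := by
    intro x r hr
    rw [closedBall_eq_rct]
    exact rct_top (a := x.1) (b := x.1 + r) ⟨by linarith, by linarith⟩ ⟨by linarith, by linarith⟩
      (by linarith)
  let R : Set Strip := {q | ∃ γ, IsHair O γ ∧ γ 1 = q}
  have step : ∀ x r, 0 < r → Metric.closedBall x r ⊆ O → ∀ y ∈ Metric.closedBall x r,
      y ∈ R → ∀ q ∈ Metric.closedBall x r, q ∈ R := by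
    rintro x r hr hsub y hy ⟨γ, hγ, h1⟩ q hq
    obtain ⟨γ', h, h', -⟩ := hair_extend hγ hsub Metric.isClosed_closedBall (hsc x r) (htp x r hr)
      (h1 ▸ hy) hq
    exact ⟨γ', h, h'⟩
  have hR0 : p0 ∈ R := by
    obtain ⟨r, hr, hsub⟩ := key p0 hp0
    obtain ⟨p, hp, hp1, hne⟩ := htp p0 r hr p0 (Metric.mem_closedBall_self hr.le) htop
    refine ⟨sgm p p0, ⟨sgm_cont _ _, sgm_inj hne, ?_, fun t =>
      hsub (hsc p0 r p hp p0 (Metric.mem_closedBall_self hr.le) t)⟩, sgm_one _ _⟩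
    rw [sgm_zero]; exact hp1
  have hR1 : IsOpen (R ∩ O) := by
    rw [Metric.isOpen_iff]
    rintro x ⟨hx, hxO⟩
    obtain ⟨r, hr, hsub⟩ := key x hxO
    exact ⟨r, hr, fun y hy => ⟨step x r hr hsub x (Metric.mem_closedBall_self hr.le) hx y
      (Metric.ball_subset_closedBall hy), hsub (Metric.ball_subset_closedBall hy)⟩⟩
  have hR2 : IsOpen (Rᶜ ∩ O) := by
    rw [Metric.isOpen_iff]
    rintro x ⟨hx, hxO⟩
    obtain ⟨r, hr, hsub⟩ := key x hxO
    exact ⟨r, hr, fun y hy => ⟨fun hyR => hx (step x r hr hsub y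
      (Metric.ball_subset_closedBall hy) hyR x (Metric.mem_closedBall_self hr.le)),
      hsub (Metric.ball_subset_closedBall hy)⟩⟩
  intro q hq
  by_contra hne
  obtain ⟨z, hz, hz1, hz2⟩ := hconn (R ∩ O) (Rᶜ ∩ O) hR1 hR2
    (fun x hx => (em (x ∈ R)).imp (fun h => ⟨h, hx⟩) (fun h => ⟨h, hx⟩))
    ⟨p0, hp0, hR0, hp0⟩ ⟨q, hq, hne, hq⟩
  exact hz2.1 hz1.1

lemma pr_cont : Continuous pr :=
  ((AddCircle.continuous_mk' (1 : ℝ)).comp continuous_fst).prodMk continuous_snd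

lemma pr_open : IsOpenMap pr := by
  have h : IsOpenMap (fun x : ℝ => (x : AddCircle (1 : ℝ))) := QuotientAddGroup.isOpenMap_coe
  exact h.prodMap IsOpenMap.id

lemma pr_shift (k : ℤ) (z : Strip) : pr (shiftPt k z) = pr z := by
  have : (((z.1 + k : ℝ)) : AddCircle (1 : ℝ)) = (z.1 : AddCircle (1 : ℝ)) := by
    have h0 : (((k : ℝ)) : AddCircle (1 : ℝ)) = 0 :=
      (AddCircle.coe_eq_zero_iff (1 : ℝ)).2 ⟨k, by simp⟩
    rw [AddCircle.coe_add, h0, add_zero]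
  exact Prod.ext this rfl

lemma shift_cont (k : ℤ) : Continuous (shiftPt k) := by
  unfold shiftPt
  fun_prop

section EAC
variable {X Um Up : Set Ann}

lemma sub_of_conn {p : Ann} {U : Set Ann} (hU : U = connectedComponentIn Xᶜ p)
    {S : Set Strip} (hS : IsPreconnected S) (hSX : ∀ z ∈ S, pr z ∉ X) {z : Strip} (hz : z ∈ S)
    (hzU : pr z ∈ U) : ∀ y ∈ S, pr y ∈ U := by
  intro y hy
  have h1 : IsPreconnected (pr '' S) := hS.image _ pr_cont.continuousOn
  have h2 := h1.subset_connectedComponentIn (mem_image_of_mem pr hz)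
    (F := Xᶜ) (by rintro _ ⟨w, hw, rfl⟩; exact hSX w hw)
  rw [hU] at hzU ⊢
  rw [connectedComponentIn_eq hzU]
  exact h2 (mem_image_of_mem pr hy)

lemma rct_pre {I J : Set ℝ} (hI : Convex ℝ I) (hJ : Convex ℝ J) : IsPreconnected (rct I J) := by
  rcases (rct I J).eq_empty_or_nonempty with h | ⟨p, hp⟩
  · rw [h]; exact isPreconnected_empty
  · exact ((rct_sconv hI hJ).isPathConnected hp).isConnected.isPreconnected

lemma pr_surj : Function.Surjective pr := by
  rintro ⟨a, b⟩
  obtain ⟨x, rfl⟩ := QuotientAddGroup.mk_surjective a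
  exact ⟨(x, b), rfl⟩

lemma strip_pre : IsPreconnected (univ : Set Strip) := by
  have : (univ : Set Strip) = rct univ univ := by ext; simp [rct]
  rw [this]
  exact rct_pre convex_univ convex_univ

lemma ann_pre : IsPreconnected (univ : Set Ann) := by
  have := strip_pre.image pr pr_cont.continuousOn
  rwa [image_univ, pr_surj.range_eq] at this

lemma top_sub (hX : IsEAC X Um Up) (z : Strip) (hz : (z.2 : ℝ) = 1) : pr z ∈ Up := by
  have hXc : ∀ y ∈ rct univ {1}, pr y ∉ X := by
    intro y hy h
    have h1 := (hX.inInterior _ h).2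
    have h2 : (y.2 : ℝ) = 1 := hy.2
    simp only [pr] at h1
    linarith
  refine sub_of_conn hX.hUp (rct_pre (I := univ) (J := {1}) convex_univ (convex_singleton _)) hXc
    (z := (0, ⟨1, by norm_num, le_rfl⟩)) ⟨trivial, rfl⟩ ?_ z ⟨trivial, hz⟩
  rw [hX.hUp]
  exact mem_connectedComponentIn (hXc (0, ⟨1, by norm_num, le_rfl⟩) ⟨trivial, rfl⟩)

lemma bot_sub (hX : IsEAC X Um Up) (z : Strip) (hz : (z.2 : ℝ) = -1) : pr z ∈ Um := by
  have hXc : ∀ y ∈ rct univ {-1}, pr y ∉ X := by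
    intro y hy h
    have h1 := (hX.inInterior _ h).1
    have h2 : (y.2 : ℝ) = -1 := hy.2
    simp only [pr] at h1
    linarith
  refine sub_of_conn hX.hUm (rct_pre (I := univ) (J := {-1}) convex_univ (convex_singleton _)) hXc
    (z := (0, ⟨-1, le_rfl, by norm_num⟩)) ⟨trivial, rfl⟩ ?_ z ⟨trivial, hz⟩
  rw [hX.hUm]
  exact mem_connectedComponentIn (hXc (0, ⟨-1, le_rfl, by norm_num⟩) ⟨trivial, rfl⟩)

lemma um_up_disj (hX : IsEAC X Um Up) {p : Ann} (h1 : p ∈ Um) (h2 : p ∈ Up) : False := by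
  apply hX.ne
  rw [hX.hUm] at h1
  rw [hX.hUp] at h2
  rw [hX.hUm, hX.hUp, connectedComponentIn_eq h1, connectedComponentIn_eq h2]

lemma comp_closed {p : Ann} (hp : p ∈ Xᶜ) {q : Ann}
    (hq : q ∈ closure (connectedComponentIn Xᶜ p)) (hqX : q ∉ X) :
    q ∈ connectedComponentIn Xᶜ p := by
  have hc : IsPreconnected (closure (connectedComponentIn Xᶜ p) ∩ Xᶜ) :=
    isPreconnected_connectedComponentIn.subset_closure
      (fun x hx => ⟨subset_closure hx, connectedComponentIn_subset _ _ hx⟩) inter_subset_left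
  exact hc.subset_connectedComponentIn ⟨subset_closure (mem_connectedComponentIn hp), hp⟩
    inter_subset_right ⟨hq, hqX⟩

lemma bot_mem (hX : IsEAC X Um Up) :
    (((0 : AddCircle (1 : ℝ)), ⟨-1, le_rfl, by norm_num⟩) : Ann) ∈ Xᶜ := by
  intro h
  exact lt_irrefl _ (hX.inInterior _ h).1

lemma top_mem (hX : IsEAC X Um Up) :
    (((0 : AddCircle (1 : ℝ)), ⟨1, by norm_num, le_rfl⟩) : Ann) ∈ Xᶜ := by
  intro h
  exact lt_irrefl _ (hX.inInterior _ h).2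

lemma um_closure (hX : IsEAC X Um Up) {q : Ann} (hq : q ∈ closure Um) (hqX : q ∉ X) : q ∈ Um := by
  rw [hX.hUm] at hq ⊢
  exact comp_closed (bot_mem hX) hq hqX

lemma up_closure (hX : IsEAC X Um Up) {q : Ann} (hq : q ∈ closure Up) (hqX : q ∉ X) : q ∈ Up := by
  rw [hX.hUp] at hq ⊢
  exact comp_closed (top_mem hX) hq hqX

lemma um_notX (hX : IsEAC X Um Up) {q : Ann} (hq : q ∈ Um) : q ∉ X := by
  have : q ∈ Xᶜ := hX.cover ▸ Or.inl hq
  exact this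

lemma up_notX (hX : IsEAC X Um Up) {q : Ann} (hq : q ∈ Up) : q ∉ X := by
  have : q ∈ Xᶜ := hX.cover ▸ Or.inr hq
  exact this

lemma up_open (hX : IsEAC X Um Up) : IsOpen Up := by
  have : Up = Xᶜ ∩ (closure Um)ᶜ := by
    ext q
    constructor
    · intro h
      exact ⟨up_notX hX h, fun h' => um_up_disj hX (um_closure hX h' (up_notX hX h)) h⟩
    · rintro ⟨h1, h2⟩
      rw [hX.cover] at h1
      exact h1.resolve_left (fun h => h2 (subset_closure h))
  rw [this]
  exact hX.compact.isClosed.isOpen_compl.inter isClosed_closure.isOpen_compl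

lemma um_open (hX : IsEAC X Um Up) : IsOpen Um := by
  have : Um = Xᶜ ∩ (closure Up)ᶜ := by
    ext q
    constructor
    · intro h
      exact ⟨um_notX hX h, fun h' => um_up_disj hX h (up_closure hX h' (um_notX hX h))⟩
    · rintro ⟨h1, h2⟩
      rw [hX.cover] at h1
      exact h1.resolve_right (fun h => h2 (subset_closure h))
  rw [this]
  exact hX.compact.isClosed.isOpen_compl.inter isClosed_closure.isOpen_compl

lemma upc_conn (hX : IsEAC X Um Up) : IsPreconnected Upᶜ := by
  have heq : Upᶜ = X ∪ closure Um := by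
    ext q
    constructor
    · intro h
      by_cases hq : q ∈ X
      · exact Or.inl hq
      · have h1 : q ∈ Xᶜ := hq
        rw [hX.cover] at h1
        exact Or.inr (subset_closure (h1.resolve_right h))
    · rintro (h | h) h'
      · exact up_notX hX h' h
      · exact um_up_disj hX (um_closure hX h (up_notX hX h')) h'
  have hne : (X ∩ closure Um).Nonempty := by
    by_contra hcon
    have hcl : IsClosed Um := by
      rw [← closure_eq_iff_isClosed]
      refine subset_antisymm (fun q hq => ?_) subset_closure
      exact um_closure hX hq (fun hqX => hcon ⟨q, hqX, hq⟩)
    have hb := bot_sub hX (0, ⟨-1, le_rfl, by norm_num⟩) rfl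
    have ht := top_sub hX (0, ⟨1, by norm_num, le_rfl⟩) rfl
    obtain ⟨z, -, h1, h2⟩ := ann_pre Um Umᶜ (um_open hX) hcl.isOpen_compl (fun x _ => em (x ∈ Um))
      ⟨_, trivial, hb⟩ ⟨_, trivial, fun h => um_up_disj hX h ht⟩
    exact h2 h1
  obtain ⟨q, h1, h2⟩ := hne
  rw [heq]
  refine IsPreconnected.union q h1 h2 hX.connected.isPreconnected ?_
  rw [hX.hUm]
  exact isPreconnected_connectedComponentIn.closure

/-- Complex coordinate. -/
def cx (z : Strip) : ℂ := ⟨z.1, z.2⟩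

lemma cx_cont : Continuous cx := by
  have : cx = fun z : Strip => ((z.1 : ℝ) : ℂ) + ((z.2 : ℝ) : ℂ) * Complex.I := by
    funext z
    apply Complex.ext <;> simp [cx]
  rw [this]
  fun_prop

lemma cx_inj : Function.Injective cx := by
  intro z w h
  have h1 : z.1 = w.1 := congrArg Complex.re h
  have h2 : (z.2 : ℝ) = w.2 := congrArg Complex.im h
  exact Prod.ext h1 (Subtype.ext h2)

/-- `z - w` has a continuous logarithm on `K`. -/
def HasLg (K : Set Strip) (w : Strip) : Prop :=
  ∃ g : Strip → ℂ, ContinuousOn g K ∧ ∀ z ∈ K, Complex.exp (g z) = cx z - cx w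

lemma hasLg_of_slit {K : Set Strip} {w : Strip} (b : ℂ)
    (h : ∀ z ∈ K, Complex.exp b * (cx z - cx w) ∈ Complex.slitPlane) : HasLg K w := by
  refine ⟨fun z => Complex.log (Complex.exp b * (cx z - cx w)) - b, ?_, ?_⟩
  · refine ContinuousOn.sub (ContinuousOn.clog ?_ h) continuousOn_const
    exact (continuous_const.mul (cx_cont.sub continuous_const)).continuousOn
  · intro z hz
    rw [Complex.exp_sub, Complex.exp_log (Complex.slitPlane_ne_zero (h z hz))]
    exact mul_div_cancel_left₀ _ (Complex.exp_ne_zero b)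

lemma hasLg_move {K : Set Strip} {w w' : Strip} (h : HasLg K w)
    (hn : ∀ z ∈ K, ‖cx w - cx w'‖ < ‖cx z - cx w‖) : HasLg K w' := by
  obtain ⟨g, hg, he⟩ := h
  have hne : ∀ z ∈ K, cx z - cx w ≠ 0 := fun z hz =>
    norm_pos_iff.1 (lt_of_le_of_lt (norm_nonneg _) (hn z hz))
  have hs : ∀ z ∈ K, 1 + (cx w - cx w') / (cx z - cx w) ∈ Complex.slitPlane := by
    intro z hz
    apply Complex.mem_slitPlane_of_norm_lt_one
    rw [norm_div, div_lt_one (norm_pos_iff.2 (hne z hz))]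
    exact hn z hz
  refine ⟨fun z => g z + Complex.log (1 + (cx w - cx w') / (cx z - cx w)), ?_, ?_⟩
  · refine hg.add (ContinuousOn.clog ?_ hs)
    exact continuousOn_const.add (continuousOn_const.div
      (cx_cont.sub continuous_const).continuousOn hne)
  · intro z hz
    rw [Complex.exp_add, he z hz, Complex.exp_log (Complex.slitPlane_ne_zero (hs z hz))]
    have := hne z hz
    field_simp
    ring

lemma hasLg_loc {K : Set Strip} (hK : IsCompact K) {w : Strip} (hw : w ∉ K) :
    ∀ᶠ w' in 𝓝 w, (HasLg K w ↔ HasLg K w') := by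
  obtain ⟨ε, hε, hεK⟩ : ∃ ε > 0, ∀ z ∈ K, ε ≤ ‖cx z - cx w‖ := by
    rcases K.eq_empty_or_nonempty with h | h
    · exact ⟨1, one_pos, by simp [h]⟩
    · obtain ⟨z, hz, hm⟩ := hK.exists_isMinOn h
        (f := fun z => ‖cx z - cx w‖) (cx_cont.sub continuous_const).norm.continuousOn
      refine ⟨_, norm_pos_iff.2 (sub_ne_zero.2 fun h => hw (by rw [← cx_inj h]; exact hz)), fun y hy => hm hy⟩
  have : ∀ᶠ w' in 𝓝 w, ‖cx w - cx w'‖ < ε / 2 := by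
    have hc : ContinuousAt (fun w' => ‖cx w - cx w'‖) w :=
      (continuous_const.sub cx_cont).norm.continuousAt
    exact hc.eventually_lt_const (by simpa using half_pos hε)
  filter_upwards [this] with w' hw'
  constructor
  · intro h
    exact hasLg_move h fun z hz => by linarith [hεK z hz]
  · intro h
    refine hasLg_move h fun z hz => ?_
    have h1 := hεK z hz
    have h2 : ‖cx z - cx w‖ ≤ ‖cx z - cx w'‖ + ‖cx w - cx w'‖ := by
      calc _ = ‖(cx z - cx w') - (cx w - cx w')‖ := by ring_nf
        _ ≤ _ := norm_sub_le _ _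
    rw [norm_sub_rev (cx w') (cx w)]
    linarith

/-- Main logarithm lemma. -/
lemma hasLg_all (hX : IsEAC X Um Up) {K : Set Strip} (hK : IsCompact K)
    (hKU : ∀ z ∈ K, pr z ∈ Up) {w : Strip} (hw : pr w ∉ Up) : HasLg K w := by
  by_contra hcon
  let G0 : Set Strip := {w | w ∉ K ∧ ¬ HasLg K w}
  let G1 : Set Strip := {w | w ∉ K ∧ HasLg K w}
  have hKo : IsOpen Kᶜ := hK.isClosed.isOpen_compl
  have hG0 : IsOpen G0 := by
    rw [isOpen_iff_eventually]
    rintro w ⟨h1, h2⟩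
    filter_upwards [hasLg_loc hK h1, hKo.mem_nhds h1] with w' h h'
    exact ⟨h', fun h3 => h2 (h.2 h3)⟩
  have hG1 : IsOpen G1 := by
    rw [isOpen_iff_eventually]
    rintro w ⟨h1, h2⟩
    filter_upwards [hasLg_loc hK h1, hKo.mem_nhds h1] with w' h h'
    exact ⟨h', h.1 h2⟩
  obtain ⟨R, hR⟩ : ∃ R : ℝ, ∀ z ∈ K, |z.1| ≤ R := by
    obtain ⟨R, hR⟩ := (hK.image continuous_fst).isBounded.exists_norm_le
    exact ⟨R, fun z hz => hR _ (mem_image_of_mem _ hz)⟩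
  have hEK : ∀ w : Strip, pr w ∉ Up → w ∉ K := fun w h h' => h (hKU w h')
  let S : Set Strip := pr ⁻¹' Upᶜ ∩ G1ᶜ
  have hSc : IsClosed S :=
    ((up_open hX).isClosed_compl.preimage pr_cont).inter hG1.isClosed_compl
  have hSb : S ⊆ Icc (-R) R ×ˢ univ := by
    rintro w ⟨h1, h2⟩
    refine ⟨?_, trivial⟩
    by_contra hw
    apply h2
    refine ⟨hEK w h1, ?_⟩
    rw [mem_Icc, not_and_or] at hw
    push Not at hw
    rcases hw with hw | hw
    · apply hasLg_of_slit 0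
      intro z hz
      left
      have := abs_le.1 (hR z hz)
      simp [cx]
      linarith
    · apply hasLg_of_slit (Real.pi * Complex.I)
      intro z hz
      left
      have := abs_le.1 (hR z hz)
      rw [Complex.exp_pi_mul_I]
      simp [cx]
      linarith
  have hScomp : IsCompact S := (isCompact_Icc.prod isCompact_univ).of_isClosed_subset hSc hSb
  have hPc : IsClosed (pr '' S) := (hScomp.image pr_cont).isClosed
  have hbot : ∀ w ∈ S, (w.2 : ℝ) ≠ -1 := by
    rintro w ⟨h1, h2⟩ hw
    apply h2
    refine ⟨hEK w h1, ?_⟩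
    apply hasLg_of_slit (-(Real.pi / 2 * Complex.I))
    intro z hz
    left
    have h3 : (z.2 : ℝ) ≠ -1 := fun h => um_up_disj hX (bot_sub hX z h) (hKU z hz)
    have h4 : (-1 : ℝ) < z.2 := lt_of_le_of_ne z.2.2.1 h3.symm
    rw [Complex.exp_neg, Complex.exp_pi_div_two_mul_I, Complex.inv_I]
    have h5 : (-Complex.I * (cx z - cx w)).re = (z.2 : ℝ) - w.2 := by simp [cx]
    rw [h5]
    linarith
  have hb := bot_sub hX (0, ⟨-1, le_rfl, by norm_num⟩) rfl
  obtain ⟨p, hp, hp1, hp2⟩ := upc_conn hX (pr '' G0) (pr '' S)ᶜ (pr_open _ hG0) hPc.isOpen_compl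
    (by
      intro p hp
      by_cases h : p ∈ pr '' S
      · obtain ⟨z, hz, rfl⟩ := h
        exact Or.inl ⟨z, ⟨hEK z hz.1, fun h' => hz.2 ⟨hEK z hz.1, h'⟩⟩, rfl⟩
      · exact Or.inr h)
    ⟨pr w, hw, w, ⟨hEK w hw, hcon⟩, rfl⟩
    ⟨_, fun h => um_up_disj hX hb h, by
      rintro ⟨z, hz, hz'⟩
      refine hbot z hz ?_
      have := congrArg (fun p : Ann => (p.2 : ℝ)) hz'
      simpa [pr] using this⟩
  obtain ⟨z, hz, rfl⟩ := hp1
  exact hp2 ⟨z, ⟨hp, fun h => hz.2 h.2⟩, rfl⟩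

/-- `β' + j`. -/
def bj (η : ℝ) (j : ℤ) : Set Strip := {z | z.1 = j ∧ η < (z.2 : ℝ)}

/-- Separation lemma. -/
lemma sep (hX : IsEAC X Um Up) {η : ℝ} (hη : etaSpec (pr ⁻¹' X) η) (j : ℤ) {K : Set Strip}
    (hK : IsCompact K) (hKc : IsPreconnected K) (hKU : ∀ z ∈ K, pr z ∈ Up)
    (hKb : ∀ z ∈ K, z ∉ bj η j) {p q : Strip} (hp : p ∈ K) (hq : q ∈ K)
    (hp1 : (p.2 : ℝ) = 1) (hq1 : (q.2 : ℝ) = 1) (hpj : p.1 < j) (hqj : (j : ℝ) < q.1) : False := by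
  obtain ⟨⟨x0, hx0, hx00, hx0η⟩, -⟩ := hη
  have hη1 : η < 1 := by
    have := (hX.inInterior _ hx0).2
    rw [← hx0η]
    exact this
  set w : Strip := shiftPt j x0 with hwdef
  have hw1 : w.1 = j := by simp [hwdef, shiftPt, hx00]
  have hw2 : (w.2 : ℝ) = η := hx0η
  have hwU : pr w ∉ Up := by
    rw [hwdef, pr_shift]
    exact fun h => up_notX hX h hx0
  let L : Set Strip := rct (Icc p.1 q.1) {1}
  have hLc : IsCompact L := by
    have h0 : IsCompact (Icc p.1 q.1 ×ˢ (univ : Set II)) := isCompact_Icc.prod isCompact_univ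
    exact h0.of_isClosed_subset (rct_closed isClosed_Icc isClosed_singleton)
      (fun z hz => ⟨hz.1, trivial⟩)
  have hLp : IsPreconnected L := rct_pre (convex_Icc _ _) (convex_singleton _)
  obtain ⟨g, hg, he⟩ := hasLg_all hX (hK.union hLc) (K := K ∪ L)
    (by
      rintro z (hz | hz)
      · exact hKU z hz
      · exact top_sub hX z hz.2) hwU
  have hre : ∀ z ∈ K ∪ L, Real.exp (g z).re * Real.cos (g z).im = z.1 - j := by
    intro z hz
    rw [← Complex.exp_re, he z hz]
    simp [cx, hw1]
  have him : ∀ z ∈ K ∪ L, Real.exp (g z).re * Real.sin (g z).im = z.2 - η := by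
    intro z hz
    rw [← Complex.exp_im, he z hz]
    simp [cx, hw2]
  have hpL : p ∈ L := ⟨⟨le_rfl, by linarith⟩, hp1⟩
  have hqL : q ∈ L := ⟨⟨by linarith, le_rfl⟩, hq1⟩
  have hθc : ContinuousOn (fun z => (g z).im) (K ∪ L) := Complex.continuous_im.comp_continuousOn hg
  have hθK := (hKc.image _ (hθc.mono subset_union_left)).ordConnected
  have hθL := (hLp.image _ (hθc.mono subset_union_right)).ordConnected
  have sinpos : ∀ z ∈ L, 0 < Real.sin (g z).im := by
    intro z hz
    have h1 := him z (Or.inr hz)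
    have h2 : (z.2 : ℝ) = 1 := hz.2
    rw [h2] at h1
    exact pos_of_mul_pos_right (by linarith) (Real.exp_pos _).le
  have cosp : Real.cos (g p).im < 0 := by
    have h1 := hre p (Or.inl hp)
    by_contra h
    push Not at h
    have := mul_nonneg (Real.exp_pos (g p).re).le h
    linarith
  have cosq : 0 < Real.cos (g q).im := by
    have h1 := hre q (Or.inl hq)
    exact pos_of_mul_pos_right (by linarith) (Real.exp_pos _).le
  have hpi := Real.pi_pos
  obtain ⟨n, hn1, hn2⟩ : ∃ n : ℤ, n * (2 * Real.pi) ≤ (g p).im ∧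
      (g p).im < n * (2 * Real.pi) + 2 * Real.pi := by
    refine ⟨⌊(g p).im / (2 * Real.pi)⌋, ?_, ?_⟩
    · rw [← le_div_iff₀ (by positivity)]
      exact Int.floor_le _
    · have := Int.lt_floor_add_one ((g p).im / (2 * Real.pi))
      rw [div_lt_iff₀ (by positivity)] at this
      linarith
  have hs : ∀ z, Real.sin (g z).im = Real.sin ((g z).im - n * (2 * Real.pi)) := fun z =>
    (Real.sin_sub_int_mul_two_pi _ _).symm
  have hcs : ∀ z, Real.cos (g z).im = Real.cos ((g z).im - n * (2 * Real.pi)) := fun z =>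
    (Real.cos_sub_int_mul_two_pi _ _).symm
  have hp3 : (g p).im < n * (2 * Real.pi) + Real.pi := by
    by_contra h
    push Not at h
    have h1 := sinpos p hpL
    have h2 : Real.sin ((g p).im - n * (2 * Real.pi)) ≤ 0 := by
      rw [← Real.sin_sub_two_pi]
      exact Real.sin_nonpos_of_nonpos_of_neg_pi_le (by linarith) (by linarith)
    rw [hs] at h1
    linarith
  have hp4 : n * (2 * Real.pi) + Real.pi / 2 < (g p).im := by
    by_contra h
    push Not at h
    have : 0 ≤ Real.cos ((g p).im - n * (2 * Real.pi)) :=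
      Real.cos_nonneg_of_neg_pi_div_two_le_of_le (by linarith) (by linarith)
    rw [hcs] at cosp
    linarith
  have hq3 : (g q).im < n * (2 * Real.pi) + Real.pi := by
    by_contra h
    push Not at h
    obtain ⟨z, hz, hz'⟩ := hθL.out (mem_image_of_mem _ hpL) (mem_image_of_mem _ hqL)
      (show n * (2 * Real.pi) + Real.pi ∈ Icc _ _ from ⟨hp3.le, h⟩)
    have h1 := sinpos z hz
    rw [hs] at h1
    simp only at hz'
    rw [hz'] at h1
    simp at h1
  have hq4 : n * (2 * Real.pi) < (g q).im := by
    by_contra h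
    push Not at h
    obtain ⟨z, hz, hz'⟩ := hθL.out (mem_image_of_mem _ hqL) (mem_image_of_mem _ hpL)
      (show n * (2 * Real.pi) ∈ Icc _ _ from ⟨h, hn1⟩)
    have h1 := sinpos z hz
    rw [hs] at h1
    simp only at hz'
    rw [hz'] at h1
    simp at h1
  have hq5 : (g q).im < n * (2 * Real.pi) + Real.pi / 2 := by
    by_contra h
    push Not at h
    have : Real.cos ((g q).im - n * (2 * Real.pi)) ≤ 0 :=
      Real.cos_nonpos_of_pi_div_two_le_of_le (by linarith) (by linarith)
    rw [hcs] at cosq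
    linarith
  obtain ⟨z, hz, hz'⟩ := hθK.out (mem_image_of_mem _ hq) (mem_image_of_mem _ hp)
    (show n * (2 * Real.pi) + Real.pi / 2 ∈ Icc _ _ from ⟨hq5.le, hp4.le⟩)
  have h1 := hre z (Or.inl hz)
  have h2 := him z (Or.inl hz)
  simp only at hz'
  rw [hcs, hz'] at h1
  rw [hs, hz'] at h2
  simp only [add_sub_cancel_left, Real.cos_pi_div_two, Real.sin_pi_div_two, mul_zero, mul_one]
    at h1 h2
  refine hKb z hz ⟨by linarith, ?_⟩
  have := Real.exp_pos (g z).re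
  linarith

/-- The open region whose relative closure is `V`. -/
def V0 (Up : Set Ann) (η : ℝ) : Set Strip :=
  connectedComponentIn (pr ⁻¹' Up \ (betaP η ∪ shiftSet 1 (betaP η))) topSeg

lemma betaP_eq (η : ℝ) : betaP η = bj η 0 := by
  ext z
  simp [betaP, bj]

lemma betaP_shift_eq (η : ℝ) : shiftSet 1 (betaP η) = bj η 1 := by
  ext z
  constructor
  · rintro ⟨y, ⟨h1, h2⟩, rfl⟩
    exact ⟨by simp [shiftPt, h1], h2⟩
  · rintro ⟨h1, h2⟩
    refine ⟨(0, z.2), ⟨rfl, h2⟩, ?_⟩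
    refine Prod.ext ?_ rfl
    simp only [shiftPt, h1]
    simp

lemma dom_eq (Up : Set Ann) (η : ℝ) :
    pr ⁻¹' Up \ (betaP η ∪ shiftSet 1 (betaP η)) = pr ⁻¹' Up \ (bj η 0 ∪ bj η 1) := by
  rw [betaP_shift_eq, betaP_eq]

lemma dom_open (hX : IsEAC X Um Up) {η : ℝ} (hη : etaSpec (pr ⁻¹' X) η) :
    IsOpen (pr ⁻¹' Up \ (bj η 0 ∪ bj η 1)) := by
  obtain ⟨⟨x0, hx0, hx00, hx0η⟩, -⟩ := hη
  have hj : ∀ j : ℤ, ∀ z : Strip, pr z ∈ Up → z ∈ rct {(j : ℝ)} (Ici η) → z ∈ bj η j := by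
    rintro j z hz ⟨h1, h2⟩
    have h1' : z.1 = j := h1
    refine ⟨h1', lt_of_le_of_ne h2 fun h => ?_⟩
    have : z = shiftPt j x0 := by
      refine Prod.ext ?_ (Subtype.ext ?_)
      · simp [shiftPt, hx00, h1']
      · simp only [shiftPt]; rw [hx0η, h]
    rw [this, pr_shift] at hz
    exact up_notX hX hz hx0
  have hj' : ∀ j : ℤ, bj η j ⊆ rct {(j : ℝ)} (Ici η) := fun j z hz => ⟨hz.1, hz.2.le⟩
  have : pr ⁻¹' Up \ (bj η 0 ∪ bj η 1) =
      pr ⁻¹' Up \ (rct {((0 : ℤ) : ℝ)} (Ici η) ∪ rct {((1 : ℤ) : ℝ)} (Ici η)) := by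
    ext z
    constructor
    · rintro ⟨h1, h2⟩
      exact ⟨h1, fun h => h2 (h.imp (hj 0 z h1) (hj 1 z h1))⟩
    · rintro ⟨h1, h2⟩
      exact ⟨h1, fun h => h2 (h.imp (fun h => hj' 0 h) (fun h => hj' 1 h))⟩
  rw [this]
  exact ((up_open hX).preimage pr_cont).sdiff
    ((rct_closed isClosed_singleton isClosed_Ici).union
      (rct_closed isClosed_singleton isClosed_Ici))

lemma topSeg_mem (hX : IsEAC X Um Up) (η : ℝ) :
    topSeg ∈ pr ⁻¹' Up \ (bj η 0 ∪ bj η 1) := by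
  refine ⟨top_sub hX _ rfl, ?_⟩
  rintro (⟨h, -⟩ | ⟨h, -⟩) <;> norm_num [topSeg] at h

lemma V0_open (hX : IsEAC X Um Up) {η : ℝ} (hη : etaSpec (pr ⁻¹' X) η) : IsOpen (V0 Up η) := by
  have := strip_lpc
  unfold V0
  rw [dom_eq]
  exact (dom_open hX hη).connectedComponentIn

lemma V0_sub (Up : Set Ann) (η : ℝ) : V0 Up η ⊆ pr ⁻¹' Up \ (bj η 0 ∪ bj η 1) := by
  unfold V0
  rw [dom_eq]
  exact connectedComponentIn_subset _ _

lemma topSeg_V0 (hX : IsEAC X Um Up) (η : ℝ) : topSeg ∈ V0 Up η := by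
  unfold V0
  rw [dom_eq]
  exact mem_connectedComponentIn (topSeg_mem hX η)

lemma V0_pre (Up : Set Ann) (η : ℝ) : IsPreconnected (V0 Up η) :=
  isPreconnected_connectedComponentIn

lemma V0_max {η : ℝ} {S : Set Strip} (hS : IsPreconnected S)
    (hSD : S ⊆ pr ⁻¹' Up \ (bj η 0 ∪ bj η 1)) {v : Strip} (hv : v ∈ S) (hv' : v ∈ V0 Up η) :
    S ⊆ V0 Up η := by
  unfold V0 at hv' ⊢
  rw [dom_eq] at hv' ⊢
  rw [connectedComponentIn_eq hv']
  exact hS.subset_connectedComponentIn hv hSD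

lemma V0_path (hX : IsEAC X Um Up) {η : ℝ} (hη : etaSpec (pr ⁻¹' X) η) {p : Strip}
    (hp : p ∈ V0 Up η) :
    ∃ K, IsCompact K ∧ IsPreconnected K ∧ K ⊆ V0 Up η ∧ topSeg ∈ K ∧ p ∈ K := by
  have := strip_lpc
  have h1 : IsConnected (V0 Up η) := ⟨⟨_, hp⟩, V0_pre Up η⟩
  rw [(V0_open hX hη).isConnected_iff_isPathConnected] at h1
  obtain ⟨γ, hγ⟩ := h1.joinedIn _ (topSeg_V0 hX η) _ hp
  refine ⟨range γ, isCompact_range γ.continuous, isPreconnected_range γ.continuous, ?_,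
    ⟨0, γ.source⟩, ⟨1, γ.target⟩⟩
  rintro _ ⟨t, rfl⟩
  exact hγ t

lemma V0_bj (hX : IsEAC X Um Up) {η : ℝ} (hη : etaSpec (pr ⁻¹' X) η) (j : ℤ) {q : Strip}
    (hq : q ∈ V0 Up η) : q ∉ bj η j := by
  intro hqj
  obtain ⟨K, hK, hKp, hKV, htK, hqK⟩ := V0_path hX hη hq
  let L : Set Strip := rct {(j : ℝ)} (Icc (q.2 : ℝ) 1)
  have hqL : q ∈ L := ⟨hqj.1, le_rfl, q.2.2.2⟩
  have hLp : IsPreconnected L := rct_pre (convex_singleton _) (convex_Icc _ _)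
  have hLc : IsCompact L := by
    have h0 : IsCompact ({(j : ℝ)} ×ˢ (univ : Set II)) := isCompact_singleton.prod isCompact_univ
    exact h0.of_isClosed_subset (rct_closed isClosed_singleton isClosed_Icc)
      (fun z hz => ⟨hz.1, trivial⟩)
  have hLX : ∀ z ∈ L, pr z ∉ X := by
    rintro z ⟨h1, h2, -⟩ hz
    have h1' : z.1 = j := h1
    have h3 := hη.2 ⟨shiftPt (-j) z, by
      show pr _ ∈ X
      rw [pr_shift]; exact hz, by simp [shiftPt, h1'], rfl⟩
    have h4 : (z.2 : ℝ) ≤ η := h3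
    have := hqj.2
    linarith
  have hLU := sub_of_conn hX.hUp hLp hLX hqL (V0_sub Up η hq).1
  have hUn : IsPreconnected (K ∪ L) := hKp.union q hqK hqL hLp
  let t : Strip := (j, ⟨1, by norm_num, le_rfl⟩)
  have htL : t ∈ L := ⟨rfl, q.2.2.2, le_rfl⟩
  have hU : ∀ z ∈ K ∪ L, pr z ∈ Up := by
    rintro z (hz | hz)
    · exact (V0_sub Up η (hKV hz)).1
    · exact hLU z hz
  have hb : ∀ i : ℤ, i ≠ j → ∀ z ∈ L, z ∉ bj η i := by
    rintro i hi z ⟨h1, -⟩ ⟨h2, -⟩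
    have h1' : z.1 = j := h1
    apply hi
    have : (i : ℝ) = j := by rw [← h1', ← h2]
    exact_mod_cast this
  have n0 : j ≠ 0 := fun h => (V0_sub Up η hq).2 (Or.inl (h ▸ hqj))
  have n1 : j ≠ 1 := fun h => (V0_sub Up η hq).2 (Or.inr (h ▸ hqj))
  rcases lt_or_gt_of_ne n0 with h | h
  · refine sep hX hη 0 (hK.union hLc) hUn hU ?_ (p := t) (q := topSeg) (Or.inr htL) (Or.inl htK)
      rfl rfl ?_ ?_
    · rintro z (hz | hz)
      · exact fun h => (V0_sub Up η (hKV hz)).2 (Or.inl h)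
      · exact hb 0 n0.symm z hz
    · show (j : ℝ) < _
      exact_mod_cast h
    · norm_num [topSeg]
  · have h2 : 1 < j := by omega
    refine sep hX hη 1 (hK.union hLc) hUn hU ?_ (p := topSeg) (q := t) (Or.inl htK) (Or.inr htL)
      rfl rfl ?_ ?_
    · rintro z (hz | hz)
      · exact fun h => (V0_sub Up η (hKV hz)).2 (Or.inr h)
      · exact hb 1 n1.symm z hz
    · norm_num [topSeg]
    · show _ < (j : ℝ)
      exact_mod_cast h2

lemma V0_shift_pos (hX : IsEAC X Um Up) {η : ℝ} (hη : etaSpec (pr ⁻¹' X) η) {k : ℤ} (hk : 0 < k)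
    {p : Strip} (hp : p ∈ V0 Up η) (hpk : shiftPt k p ∈ V0 Up η) : False := by
  obtain ⟨K, hK, hKp, hKV, htK, hpK⟩ := V0_path hX hη hp
  obtain ⟨L, hL, hLp, hLV, htL, hpL⟩ := V0_path hX hη hpk
  have hK' : IsCompact (shiftPt k '' K) := hK.image (shift_cont k)
  have hKp' : IsPreconnected (shiftPt k '' K) := hKp.image _ (shift_cont k).continuousOn
  refine sep hX hη 1 (hL.union hK') (hLp.union (shiftPt k p) hpL ⟨p, hpK, rfl⟩ hKp') ?_ ?_
    (p := topSeg) (q := shiftPt k topSeg) (Or.inl htL) (Or.inr ⟨_, htK, rfl⟩) rfl rfl ?_ ?_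
  · rintro _ (hz | ⟨z, hz, rfl⟩)
    · exact (V0_sub Up η (hLV hz)).1
    · rw [pr_shift]; exact (V0_sub Up η (hKV hz)).1
  · rintro _ (hz | ⟨z, hz, rfl⟩) h
    · exact V0_bj hX hη 1 (hLV hz) h
    · refine V0_bj hX hη (1 - k) (hKV hz) ⟨?_, h.2⟩
      have h1 : z.1 + k = (1 : ℤ) := h.1
      push_cast at h1 ⊢
      linarith
  · norm_num [topSeg]
  · have : (1 : ℝ) ≤ k := by exact_mod_cast hk
    simp only [shiftPt, topSeg]
    push_cast
    linarith

lemma shift_shift (a b : ℤ) (z : Strip) : shiftPt a (shiftPt b z) = shiftPt (a + b) z := by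
  refine Prod.ext ?_ rfl
  simp only [shiftPt]
  push_cast
  ring

lemma shift_zero (z : Strip) : shiftPt 0 z = z := by
  refine Prod.ext ?_ rfl
  simp [shiftPt]

lemma V0_shift (hX : IsEAC X Um Up) {η : ℝ} (hη : etaSpec (pr ⁻¹' X) η) {a b : ℤ}
    {p : Strip} (hp : shiftPt a p ∈ V0 Up η) (hpk : shiftPt b p ∈ V0 Up η) : a = b := by
  rcases lt_trichotomy a b with h | h | h
  · exfalso
    refine V0_shift_pos hX hη (k := b - a) (by omega) hp ?_
    rw [shift_shift]
    simpa using hpk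
  · exact h
  · exfalso
    refine V0_shift_pos hX hη (k := a - b) (by omega) hpk ?_
    rw [shift_shift]
    simpa using hp

lemma rct_closure {a b c d : ℝ} {ctr : Strip} (hc : ctr ∈ rct (Ioo a b) (Ioo c d)) :
    rct (Icc a b) (Icc c d) ⊆ closure (rct (Ioo a b) (Ioo c d)) := by
  intro y hy
  have h1 : Tendsto (sgm y ctr) (𝓝[>] 0) (𝓝 y) := by
    have := (sgm_cont y ctr).tendsto 0
    rw [sgm_zero] at this
    exact this.mono_left nhdsWithin_le_nhds
  have : (𝓝[>] (0 : unitInterval)).NeBot := nhdsGT_neBot_of_exists_gt ⟨1, by norm_num⟩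
  refine mem_closure_of_tendsto h1 ?_
  filter_upwards [self_mem_nhdsWithin] with t ht
  have ht0 : (0 : ℝ) < t := ht
  have ht1 : (0 : ℝ) ≤ 1 - t := sub_nonneg.2 t.2.2
  obtain ⟨⟨y1, y2⟩, y3, y4⟩ := hy
  obtain ⟨⟨c1, c2⟩, c3, c4⟩ := hc
  refine ⟨⟨?_, ?_⟩, ?_, ?_⟩ <;> simp only [sgm] <;> nlinarith

/-- Hairs in half boxes. -/
lemma half_box (hX : IsEAC X Um Up) {η : ℝ} (hη : etaSpec (pr ⁻¹' X) η) {a b c d : ℝ}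
    (hab : a < b) (hnoint : ∀ n : ℤ, (n : ℝ) ∉ Ioo a b) {ctr : Strip}
    (hc : ctr ∈ rct (Ioo a b) (Ioo c d)) (hB : ∀ y ∈ rct (Icc a b) (Icc c d), pr y ∈ Up) :
    ∃ M : ℝ, ∀ y ∈ rct (Icc a b) (Icc c d), ∀ k : ℤ,
      (V0 Up η ∩ rct (Ioo (a + k) (b + k)) (Ioo c d)).Nonempty →
      ∃ γ, IsHair (Vset (pr ⁻¹' Up) η) γ ∧ γ 1 = shiftPt k y ∧
        sSup (proj1 γ) - sInf (proj1 γ) ≤ M := by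
  have hBk : ∀ k : ℤ, ∀ y ∈ rct (Icc (a + k) (b + k)) (Icc c d), pr y ∈ Up := by
    rintro k y ⟨⟨h1, h2⟩, h3⟩
    rw [← pr_shift (-k)]
    refine hB _ ⟨⟨?_, ?_⟩, h3⟩ <;> simp only [shiftPt] <;> push_cast <;> linarith
  have hQV : ∀ k : ℤ, (V0 Up η ∩ rct (Ioo (a + k) (b + k)) (Ioo c d)).Nonempty →
      rct (Ioo (a + k) (b + k)) (Ioo c d) ⊆ V0 Up η := by
    rintro k ⟨v, hv, hv'⟩
    refine V0_max (rct_pre (convex_Ioo _ _) (convex_Ioo _ _)) ?_ hv' hv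
    rintro y ⟨h1, h3⟩
    have hn : ∀ n : ℤ, y ∉ bj η n := by
      rintro n ⟨h, -⟩
      rw [h] at h1
      refine hnoint (n - k) ⟨?_, ?_⟩ <;> push_cast <;> linarith [h1.1, h1.2]
    exact ⟨hBk k y ⟨Ioo_subset_Icc_self h1, Ioo_subset_Icc_self h3⟩,
      fun h => h.elim (hn 0) (hn 1)⟩
  have hck : ∀ k : ℤ, shiftPt k ctr ∈ rct (Ioo (a + k) (b + k)) (Ioo c d) := by
    rintro k
    refine ⟨⟨?_, ?_⟩, hc.2⟩ <;> simp only [shiftPt] <;> linarith [hc.1.1, hc.1.2]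
  by_cases hex : ∃ k : ℤ, (V0 Up η ∩ rct (Ioo (a + k) (b + k)) (Ioo c d)).Nonempty
  swap
  · exact ⟨0, fun y _ k hk => absurd ⟨k, hk⟩ hex⟩
  obtain ⟨k0, hk0⟩ := hex
  have hctr : shiftPt k0 ctr ∈ V0 Up η := hQV k0 hk0 (hck k0)
  obtain ⟨γ, hγ, hγ1⟩ := hair_exists (V0_open hX hη) (V0_pre Up η) (topSeg_V0 hX η) rfl _ hctr
  have hVV : V0 Up η ⊆ Vset (pr ⁻¹' Up) η := fun z hz =>
    ⟨(V0_sub Up η hz).1, subset_closure hz⟩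
  have hγ' : IsHair (Vset (pr ⁻¹' Up) η) γ := ⟨hγ.1, hγ.2.1, hγ.2.2.1, fun t => hVV (hγ.2.2.2 t)⟩
  obtain ⟨A, hA⟩ := ((isCompact_range hγ.1).image continuous_fst).isBounded.exists_norm_le
  have hA' : ∀ t, |(γ t).1| ≤ A := fun t => hA _ ⟨γ t, ⟨t, rfl⟩, rfl⟩
  set A' : ℝ := A + |a + k0| + |b + k0| with hA'def
  refine ⟨A' - -A', fun y hy k hk => ?_⟩
  obtain rfl : k0 = k := V0_shift hX hη hctr (hQV k hk (hck k))
  have hBV : rct (Icc (a + k0) (b + k0)) (Icc c d) ⊆ Vset (pr ⁻¹' Up) η := fun z hz =>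
    ⟨hBk k0 z hz, closure_mono (hQV k0 hk0) (rct_closure (hck k0) hz)⟩
  obtain ⟨δ, hδ, hδ1, hδr⟩ := hair_extend hγ' hBV (rct_closed isClosed_Icc isClosed_Icc)
    (rct_sconv (convex_Icc _ _) (convex_Icc _ _))
    (rct_top (a := a + k0) (b := b + k0) ⟨le_rfl, by linarith⟩ ⟨by linarith, le_rfl⟩ (by linarith))
    (by rw [hγ1]; exact ⟨Ioo_subset_Icc_self (hck k0).1, Ioo_subset_Icc_self (hck k0).2⟩)
    (q := shiftPt k0 y)
    (by
      refine ⟨⟨?_, ?_⟩, hy.2⟩ <;> simp only [shiftPt] <;> linarith [hy.1.1, hy.1.2])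
  refine ⟨δ, hδ, hδ1, ?_⟩
  have hbd : ∀ x ∈ proj1 δ, -A' ≤ x ∧ x ≤ A' := by
    rintro _ ⟨t, rfl⟩
    have e1 := abs_nonneg (a + k0)
    have e2 := abs_nonneg (b + k0)
    have e3 := (abs_nonneg _).trans (hA' 0)
    rcases hδr ⟨t, rfl⟩ with ⟨s, hs⟩ | h
    · have := abs_le.1 (hA' s)
      simp only
      rw [← hs]
      constructor <;> linarith
    · have h1 := h.1.1
      have h2 := h.1.2
      have := neg_abs_le (a + k0)
      have := le_abs_self (b + k0)
      constructor <;> simp only <;> linarith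
  have hne : (proj1 δ).Nonempty := ⟨_, 0, rfl⟩
  exact sub_le_sub (csSup_le hne fun x hx => (hbd x hx).2) (le_csInf hne fun x hx => (hbd x hx).1)

/-- Local bound. -/
lemma local_bound (hX : IsEAC X Um Up) {η : ℝ} (hη : etaSpec (pr ⁻¹' X) η) {z : Strip}
    (hz : pr z ∈ Up) :
    ∃ N ∈ 𝓝 z, ∃ M : ℝ, ∀ y ∈ N, ∀ k : ℤ, shiftPt k y ∈ Vset (pr ⁻¹' Up) η →
      ∃ γ, IsHair (Vset (pr ⁻¹' Up) η) γ ∧ γ 1 = shiftPt k y ∧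
        sSup (proj1 γ) - sInf (proj1 γ) ≤ M := by
  obtain ⟨ε, hε, hεU⟩ : ∃ ε > 0, Metric.closedBall z ε ⊆ pr ⁻¹' Up :=
    Metric.nhds_basis_closedBall.mem_iff.1 (((up_open hX).preimage pr_cont).mem_nhds hz)
  set s := z.1 with hs
  set r : ℝ := min ε (min (s - (⌈s⌉ - 1)) (⌊s⌋ + 1 - s)) with hr
  have r1 : r ≤ ε := min_le_left _ _
  have r2 : r ≤ s - (⌈s⌉ - 1) := (min_le_right _ _).trans (min_le_left _ _)
  have r3 : r ≤ ⌊s⌋ + 1 - s := (min_le_right _ _).trans (min_le_right _ _)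
  have r0 : 0 < r := by
    refine lt_min hε (lt_min ?_ ?_)
    · linarith [Int.ceil_lt_add_one s]
    · linarith [Int.lt_floor_add_one s]
  have hrU : rct (Icc (s - r) (s + r)) (Icc ((z.2 : ℝ) - r) (z.2 + r)) ⊆ pr ⁻¹' Up := by
    rw [← closedBall_eq_rct]
    exact (Metric.closedBall_subset_closedBall r1).trans hεU
  obtain ⟨M1, hM1⟩ := half_box hX hη (a := s - r) (b := s) (c := (z.2 : ℝ) - r) (d := z.2 + r)
    (by linarith)
    (by
      rintro n ⟨h1, h2⟩
      have h3 : n < ⌈s⌉ := Int.lt_ceil.2 h2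
      have h4 : (n : ℝ) ≤ ⌈s⌉ - 1 := by exact_mod_cast Int.le_sub_one_of_lt h3
      linarith)
    (ctr := (s - r / 2, z.2))
    ⟨⟨by simp only; linarith, by simp only; linarith⟩,
      by simp only; linarith, by simp only; linarith⟩
    (fun y hy => hrU ⟨⟨hy.1.1, by linarith [hy.1.2]⟩, hy.2⟩)
  obtain ⟨M2, hM2⟩ := half_box hX hη (a := s) (b := s + r) (c := (z.2 : ℝ) - r) (d := z.2 + r)
    (by linarith)
    (by
      rintro n ⟨h1, h2⟩
      have h3 : ⌊s⌋ < n := Int.floor_lt.2 h1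
      have h4 : (⌊s⌋ : ℝ) + 1 ≤ n := by exact_mod_cast h3
      linarith)
    (ctr := (s + r / 2, z.2))
    ⟨⟨by simp only; linarith, by simp only; linarith⟩,
      by simp only; linarith, by simp only; linarith⟩
    (fun y hy => hrU ⟨⟨by linarith [hy.1.1], hy.1.2⟩, hy.2⟩)
  refine ⟨Metric.ball z r, Metric.ball_mem_nhds z r0, max M1 M2, ?_⟩
  intro y hy k hyk
  rw [ball_eq_rct] at hy
  obtain ⟨⟨y1, y2⟩, y3⟩ := hy
  have y3' := Ioo_subset_Icc_self y3
  have L : y.1 ≤ s → (V0 Up η ∩ rct (Ioo (s - r + k) (s + k))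
      (Ioo ((z.2 : ℝ) - r) (z.2 + r))).Nonempty →
      ∃ γ, IsHair (Vset (pr ⁻¹' Up) η) γ ∧ γ 1 = shiftPt k y ∧
        sSup (proj1 γ) - sInf (proj1 γ) ≤ max M1 M2 := by
    intro h h'
    obtain ⟨γ, g1, g2, g3⟩ := hM1 y ⟨⟨y1.le, h⟩, y3'⟩ k h'
    exact ⟨γ, g1, g2, g3.trans (le_max_left _ _)⟩
  have R : s ≤ y.1 → (V0 Up η ∩ rct (Ioo (s + k) (s + r + k))
      (Ioo ((z.2 : ℝ) - r) (z.2 + r))).Nonempty →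
      ∃ γ, IsHair (Vset (pr ⁻¹' Up) η) γ ∧ γ 1 = shiftPt k y ∧
        sSup (proj1 γ) - sInf (proj1 γ) ≤ max M1 M2 := by
    intro h h'
    obtain ⟨γ, g1, g2, g3⟩ := hM2 y ⟨⟨h, y2.le⟩, y3'⟩ k h'
    exact ⟨γ, g1, g2, g3.trans (le_max_right _ _)⟩
  have hcl : shiftPt k y ∈ closure (V0 Up η) := hyk.2
  have meets : ∀ a b : ℝ, a < y.1 + k → y.1 + k < b → (V0 Up η ∩ rct (Ioo a b)
      (Ioo ((z.2 : ℝ) - r) (z.2 + r))).Nonempty := by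
    intro a b ha hb
    obtain ⟨v, h1, h2⟩ := mem_closure_iff.1 hcl _ (rct_open (isOpen_Ioo (a := a) (b := b))
      (isOpen_Ioo (a := (z.2 : ℝ) - r) (b := z.2 + r))) ⟨⟨ha, hb⟩, y3⟩
    exact ⟨v, h2, h1⟩
  rcases lt_trichotomy y.1 s with h | h | h
  · exact L h.le (meets _ _ (by linarith) (by linarith))
  · obtain ⟨v, hv, ⟨v1, v2⟩, v3⟩ := meets (s - r + k) (s + r + k) (by linarith) (by linarith)
    rcases lt_trichotomy v.1 (s + k) with h' | h' | h'
    · exact L h.le ⟨v, hv, ⟨v1, h'⟩, v3⟩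
    · obtain ⟨ρ, hρ, hsub⟩ := Metric.isOpen_iff.1 (V0_open hX hη) v hv
      refine L h.le ⟨(v.1 - min ρ r / 2, v.2), hsub ?_, ⟨?_, ?_⟩, v3⟩
      · have h3 : 0 < min ρ r := lt_min hρ r0
        have h4 := min_le_left ρ r
        rw [ball_eq_rct]
        refine ⟨⟨?_, ?_⟩, ?_, ?_⟩ <;> simp only <;> linarith
      · have h4 := min_le_right ρ r
        simp only; linarith
      · have h3 : 0 < min ρ r := lt_min hρ r0
        simp only; linarith
    · exact R h.ge ⟨v, hv, ⟨h', v2⟩, v3⟩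
  · exact R h.le (meets _ _ (by linarith) (by linarith))

lemma disp_shift {f : Ann → Ann} {F : Strip → Strip} (hF : IsLift f F) (m : ℕ) (k : ℤ) (z : Strip) :
    (F^[m] (shiftPt k z)).1 - (shiftPt k z).1 = (F^[m] z).1 - z.1 := by
  have h1 : ∀ z, (F^[m] (shiftPt 1 z)).1 - (shiftPt 1 z).1 = (F^[m] z).1 - z.1 := by
    intro z
    have hc : Function.Commute F (shiftPt 1) := hF.2
    rw [(hc.iterate_left m).eq z]
    simp only [shiftPt]
    ring
  induction k using Int.induction_on with
  | zero => rw [shift_zero]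
  | succ i ih =>
    have h := h1 (shiftPt i z)
    rw [shift_shift, add_comm] at h
    exact h.trans ih
  | pred i ih =>
    have h := h1 (shiftPt (-(i : ℤ) - 1) z)
    rw [shift_shift, show (1 : ℤ) + (-(i : ℤ) - 1) = -i by ring] at h
    exact h.symm.trans ih

end EAC

/-- second part of Lemma `aladerecha`: there is `M > 1` such that every point
of `V` all of whose hairs have first-coordinate diameter `> M` is displaced to the right by
at least `1/2` under `f̃^m`. -/
theorem displacement_of_long_haired_points
    (f : Ann ≃ₜ Ann) (hf : IsotopicToId ⇑f)
    (F : Strip ≃ₜ Strip) (hF : IsLift ⇑f ⇑F)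
    (X Um Up : Set Ann) (hX : IsEAC X Um Up) (hinv : ⇑f '' X = X)
    (η : ℝ) (hη : etaSpec (pr ⁻¹' X) η)
    (m : ℕ) (hm : 1 ≤ m)
    (hdisp : ∀ z ∈ pr ⁻¹' X, ((⇑F)^[m] z).1 ≥ z.1 + 1) :
    ∃ M : ℝ, M > 1 ∧ ∀ x ∈ Vset (pr ⁻¹' Up) η,
      (∀ γ : unitInterval → Strip, IsHair (Vset (pr ⁻¹' Up) η) γ → γ 1 = x →
        sSup (proj1 γ) - sInf (proj1 γ) > M) →
      ((⇑F)^[m] x).1 ≥ x.1 + 1 / 2 := by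
  classical
  have hdc : Continuous fun z : Strip => ((⇑F)^[m] z).1 - z.1 :=
    (continuous_fst.comp (F.continuous.iterate m)).sub continuous_fst
  let D : Set Strip := {z | z.1 ∈ Icc (0 : ℝ) 1 ∧ pr z ∉ Um ∧ ((⇑F)^[m] z).1 - z.1 ≤ 1 / 2}
  have hDc : IsCompact D := by
    have h0 : IsCompact (Icc (0 : ℝ) 1 ×ˢ (univ : Set II)) := isCompact_Icc.prod isCompact_univ
    refine h0.of_isClosed_subset ?_ (fun z hz => ⟨hz.1, trivial⟩)
    exact (isClosed_Icc.preimage continuous_fst).inter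
      (((um_open hX).isClosed_compl.preimage pr_cont).inter (isClosed_le hdc continuous_const))
  have hDU : ∀ z ∈ D, pr z ∈ Up := by
    rintro z ⟨-, h2, h3⟩
    have hzX : pr z ∈ Xᶜ := by
      intro h
      have := hdisp z h
      linarith
    rw [hX.cover] at hzX
    exact hzX.resolve_left h2
  obtain ⟨M, hM⟩ : ∃ M : ℝ, ∀ y ∈ D, ∀ k : ℤ, shiftPt k y ∈ Vset (pr ⁻¹' Up) η →
      ∃ γ, IsHair (Vset (pr ⁻¹' Up) η) γ ∧ γ 1 = shiftPt k y ∧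
        sSup (proj1 γ) - sInf (proj1 γ) ≤ M := by
    refine hDc.induction_on (p := fun S => ∃ M : ℝ, ∀ y ∈ S, ∀ k : ℤ,
      shiftPt k y ∈ Vset (pr ⁻¹' Up) η → ∃ γ, IsHair (Vset (pr ⁻¹' Up) η) γ ∧
        γ 1 = shiftPt k y ∧ sSup (proj1 γ) - sInf (proj1 γ) ≤ M) ?_ ?_ ?_ ?_
    · exact ⟨0, fun y hy => absurd hy (notMem_empty y)⟩
    · rintro S T hST ⟨M, hM⟩
      exact ⟨M, fun y hy => hM y (hST hy)⟩
    · rintro S T ⟨M, hM⟩ ⟨M', hM'⟩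
      refine ⟨max M M', ?_⟩
      rintro y (hy | hy) k hk
      · obtain ⟨γ, g1, g2, g3⟩ := hM y hy k hk
        exact ⟨γ, g1, g2, g3.trans (le_max_left _ _)⟩
      · obtain ⟨γ, g1, g2, g3⟩ := hM' y hy k hk
        exact ⟨γ, g1, g2, g3.trans (le_max_right _ _)⟩
    · intro z hz
      obtain ⟨N, hN, h⟩ := local_bound hX hη (hDU z hz)
      exact ⟨N, mem_nhdsWithin_of_mem_nhds hN, h⟩
  refine ⟨max M 2, lt_of_lt_of_le one_lt_two (le_max_right _ _), ?_⟩
  intro x hx hlong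
  by_contra hcon
  push Not at hcon
  have hback : shiftPt ⌊x.1⌋ (shiftPt (-⌊x.1⌋) x) = x := by
    rw [shift_shift, add_neg_cancel, shift_zero]
  have hyD : shiftPt (-⌊x.1⌋) x ∈ D := by
    refine ⟨⟨?_, ?_⟩, ?_, ?_⟩
    · simp only [shiftPt]
      push_cast
      linarith [Int.floor_le x.1]
    · simp only [shiftPt]
      push_cast
      linarith [Int.lt_floor_add_one x.1]
    · rw [pr_shift]
      exact fun h => um_up_disj hX h hx.1
    · rw [disp_shift hF]
      linarith
  obtain ⟨γ, g1, g2, g3⟩ := hM _ hyD ⌊x.1⌋ (by rw [hback]; exact hx)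
  rw [hback] at g2
  have := hlong γ g1 g2
  linarith [le_max_left M 2]
end

section
/- Let X ⊂ int(𝔸) be an essential annular continuum. Then every point x ∈ X̃ accessible from Ũ₊ is accessible from V + k for some k ∈ ℤ (i.e. there is an arc γ : [0,1] → (V+k) ∪ {x} with γ([0,1)) ⊂ V+k and γ(1) = x). -/
open Set Function MeasureTheory Filter Topology

namespace AccAux

/-- The top height. -/
def one' : II := ⟨1, by norm_num, le_rfl⟩

/-- The closed union of all translates of `β`. -/
def Bbar (η : ℝ) : Set Strip := {z : Strip | z.1 ∈ range ((↑) : ℤ → ℝ) ∧ η ≤ (z.2 : ℝ)}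

lemma isClosed_Bbar (η : ℝ) : IsClosed (Bbar η) := by
  have h1 : IsClosed {z : Strip | z.1 ∈ range ((↑) : ℤ → ℝ)} :=
    Int.isClosedEmbedding_coe_real.isClosed_range.preimage continuous_fst
  have h2 : IsClosed {z : Strip | η ≤ (z.2 : ℝ)} :=
    isClosed_le continuous_const (continuous_subtype_val.comp continuous_snd)
  exact h1.inter h2

lemma continuous_pr : Continuous pr :=
  ((AddCircle.continuous_mk' (1 : ℝ)).comp continuous_fst).prodMk continuous_snd

lemma continuous_shiftPt (k : ℤ) : Continuous (shiftPt k) := by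
  unfold shiftPt; fun_prop

lemma pr_shiftPt (k : ℤ) (z : Strip) : pr (shiftPt k z) = pr z := by
  unfold pr shiftPt
  ext1
  · have : ((k : ℝ) : AddCircle (1 : ℝ)) = 0 := by
      rw [AddCircle.coe_eq_zero_iff]; exact ⟨k, by simp⟩
    simp [this]
  · rfl

lemma shift_shift (j k : ℤ) (z : Strip) : shiftPt j (shiftPt k z) = shiftPt (k + j) z := by
  unfold shiftPt; ext1 <;> simp [add_assoc]

lemma shift_zero (z : Strip) : shiftPt 0 z = z := by
  unfold shiftPt; ext1 <;> simp

lemma pr_eq {z w : Strip} (h : pr z = pr w) : ∃ k : ℤ, shiftPt k z = w := by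
  unfold pr at h
  rw [Prod.ext_iff] at h
  obtain ⟨h1, h2⟩ := h
  have h1' : ((w.1 - z.1 : ℝ) : AddCircle (1 : ℝ)) = 0 := by
    rw [AddCircle.coe_sub]; simp only at h1; rw [h1, sub_self]
  rw [AddCircle.coe_eq_zero_iff] at h1'
  obtain ⟨k, hk⟩ := h1'
  refine ⟨k, ?_⟩
  unfold shiftPt
  ext1
  · simp at hk ⊢; linarith
  · exact h2

lemma isOpenMap_pr : IsOpenMap pr := by
  have h : IsOpenMap ((↑) : ℝ → AddCircle (1 : ℝ)) := QuotientAddGroup.isOpenMap_coe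
  exact h.prodMap IsOpenMap.id

/-- The complement of all translates of `β'` in `Ũ₊`. -/
def NN (Up : Set Ann) (η : ℝ) : Set Strip := pr ⁻¹' Up \ Bbar η

/-- The components of `NN` on the top segments. -/
def WW (Up : Set Ann) (η : ℝ) (k : ℤ) : Set Strip :=
  connectedComponentIn (NN Up η) (shiftPt k topSeg)

lemma shift_mem_NN {Up : Set Ann} {η : ℝ} (j : ℤ) {z : Strip} (hz : z ∈ NN Up η) :
    shiftPt j z ∈ NN Up η := by
  refine ⟨?_, ?_⟩
  · have := hz.1
    simpa [pr_shiftPt] using this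
  · rintro ⟨⟨m, hm⟩, h2⟩
    refine hz.2 ⟨⟨m - j, ?_⟩, h2⟩
    have : (m : ℝ) = z.1 + j := hm
    push_cast; linarith

lemma shift_mem_WW {Up : Set Ann} {η : ℝ} (j k : ℤ) {z : Strip} (hz : z ∈ WW Up η k) :
    shiftPt j z ∈ WW Up η (k + j) := by
  have hmem : shiftPt k topSeg ∈ NN Up η := by
    by_contra h
    have : WW Up η k = ∅ := connectedComponentIn_eq_empty h
    rw [this] at hz; exact hz
  have hpre : IsPreconnected (shiftPt j '' WW Up η k) :=
    isPreconnected_connectedComponentIn.image _ (continuous_shiftPt j).continuousOn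
  refine hpre.subset_connectedComponentIn ?_ ?_ (mem_image_of_mem _ hz)
  · exact ⟨_, mem_connectedComponentIn hmem, shift_shift j k _⟩
  · rintro _ ⟨w, hw, rfl⟩
    exact shift_mem_NN j (connectedComponentIn_subset _ _ hw)

lemma preconn_Icc (y : II) : IsPreconnected (Icc y one') := by
  rw [← IsInducing.subtypeVal.isPreconnected_image]
  have : (Subtype.val '' Icc y one' : Set ℝ) = Icc (y : ℝ) 1 := by
    ext c
    constructor
    · rintro ⟨b, hb, rfl⟩
      exact ⟨hb.1, hb.2⟩
    · intro hc
      exact ⟨⟨c, y.2.1.trans hc.1, hc.2⟩, ⟨hc.1, hc.2⟩, rfl⟩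
  rw [this]
  exact isPreconnected_Icc

section main
variable {X Um Up : Set Ann} {η : ℝ}

lemma isOpen_Up (hX : IsEAC X Um Up) : IsOpen Up := by
  have : LocallyConnectedSpace II := by
    have : LocallyPathConnectedSpace II := (convex_Icc (-1 : ℝ) 1).locallyPathConnectedSpace
    infer_instance
  have : LocallyConnectedSpace (AddCircle (1 : ℝ)) :=
    (isQuotientMap_quotient_mk').locallyConnectedSpace
  have : LocallyConnectedSpace Ann := inferInstance
  rw [hX.hUp]
  exact hX.compact.isClosed.isOpen_compl.connectedComponentIn

lemma top_mem (hX : IsEAC X Um Up) (a : ℝ) : ((a, one') : Strip) ∈ pr ⁻¹' Up := by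
  have hpre : IsPreconnected (range fun b : ℝ => pr (b, one')) :=
    isPreconnected_range (continuous_pr.comp (by fun_prop))
  have := hpre.subset_connectedComponentIn (F := Xᶜ)
    (x := ((0 : AddCircle (1 : ℝ)), ⟨1, by norm_num, le_rfl⟩)) ⟨0, by simp [pr, one']⟩ (by
      rintro _ ⟨b, rfl⟩ hb
      have := hX.inInterior _ hb
      simp [pr, one'] at this)
  rw [← hX.hUp] at this
  exact this ⟨a, rfl⟩

lemma eta_lt (hX : IsEAC X Um Up) (hη : etaSpec (pr ⁻¹' X) η) : η ∈ Ioo (-1 : ℝ) 1 := by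
  obtain ⟨z, hz, h1, h2⟩ := hη.1
  rw [← h2]
  exact hX.inInterior _ hz

lemma Up_disj (hX : IsEAC X Um Up) {p : Ann} (h : p ∈ Up) : p ∉ X := by
  rw [hX.hUp] at h
  exact connectedComponentIn_subset _ _ h

lemma int_shift (k : ℤ) (y : II) : ((k : ℝ), y) = shiftPt k ((0 : ℝ), y) := by
  unfold shiftPt; simp

/-- Points of the translates of `β'` lie in `Ũ₊`. -/
lemma beta_mem (hX : IsEAC X Um Up) (hη : etaSpec (pr ⁻¹' X) η) (k : ℤ) (y : II)
    (hy : η < y) : (((k : ℝ), y) : Strip) ∈ pr ⁻¹' Up := by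
  have hpre : IsPreconnected ((fun b : II => pr ((0 : ℝ), b)) '' Icc y one') := by
    exact (preconn_Icc y).image _ (continuous_pr.comp (by fun_prop)).continuousOn
  have := hpre.subset_connectedComponentIn (F := Xᶜ)
    (x := ((0 : AddCircle (1 : ℝ)), ⟨1, by norm_num, le_rfl⟩))
    ⟨one', ⟨y.2.2, le_rfl⟩, by simp [pr, one']⟩ (by
      rintro _ ⟨b, hb, rfl⟩ hbX
      have h3 : (b : ℝ) ≤ η := hη.2 ⟨((0 : ℝ), b), hbX, rfl, rfl⟩
      have h4 : (y : ℝ) ≤ b := hb.1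
      linarith)
  rw [← hX.hUp] at this
  rw [int_shift, mem_preimage, pr_shiftPt]
  exact this ⟨y, ⟨le_rfl, y.2.2⟩, rfl⟩

lemma isOpen_NN (hX : IsEAC X Um Up) : IsOpen (NN Up η) :=
  ((isOpen_Up hX).preimage continuous_pr).sdiff (isClosed_Bbar η)

/-- The top segments are in the components. -/
lemma top_WW (hX : IsEAC X Um Up) (k : ℤ) {a : ℝ} (ha : a ∈ Ioo (k : ℝ) (k + 1)) :
    ((a, one') : Strip) ∈ WW Up η k := by
  have hpre : IsPreconnected ((fun b : ℝ => ((b, one') : Strip)) '' Ioo (k : ℝ) (k + 1)) :=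
    isPreconnected_Ioo.image _ (by fun_prop)
  refine hpre.subset_connectedComponentIn ?_ ?_ (mem_image_of_mem _ ha)
  · refine ⟨k + 1 / 2, ⟨by linarith, by linarith⟩, ?_⟩
    unfold shiftPt topSeg one'
    ext1
    · simp; ring
    · rfl
  · rintro _ ⟨b, hb, rfl⟩
    refine ⟨top_mem hX b, ?_⟩
    rintro ⟨⟨m, hm⟩, -⟩
    have hm : (m : ℝ) = b := hm
    rw [← hm] at hb
    have h1 : k < m := by exact_mod_cast hb.1
    have h2 : m < k + 1 := by exact_mod_cast hb.2
    omega

/-- The basic box near a translate of `β'`. -/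
lemma box (hX : IsEAC X Um Up) (hη : etaSpec (pr ⁻¹' X) η) (k : ℤ) (y : II)
    (hy : η < y) : ∃ δ > 0, ∀ a : ℝ, ∀ b : II, y ≤ b →
      (a ∈ Ioo (k : ℝ) (k + δ) → ((a, b) : Strip) ∈ WW Up η k) ∧
      (a ∈ Ioo (k - δ : ℝ) k → ((a, b) : Strip) ∈ WW Up η (k - 1)) := by
  obtain ⟨u, v, hu, hv, hku, hyv, huv⟩ := generalized_tube_lemma (s := {(k : ℝ)})
    isCompact_singleton (t := Icc y one') isClosed_Icc.isCompact
    ((isOpen_Up hX).preimage continuous_pr) (by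
      rintro ⟨a, b⟩ ⟨ha, hb⟩
      simp only [mem_singleton_iff] at ha
      subst ha
      have : (y : ℝ) ≤ b := hb.1
      exact beta_mem hX hη k b (by linarith))
  obtain ⟨ε, hε, hball⟩ := Metric.isOpen_iff.1 hu k (hku rfl)
  -- every vertical segment off the integers, inside the box, lies in one component
  have key : ∀ a : ℝ, a ∈ Ioo (k - min ε 1 : ℝ) (k + min ε 1) → a ≠ k → ∀ j : ℤ,
      a ∈ Ioo (j : ℝ) (j + 1) → ∀ b : II, y ≤ b → ((a, b) : Strip) ∈ WW Up η j := by
    intro a ha hak j haj b hb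
    have hpre : IsPreconnected ((fun c : II => ((a, c) : Strip)) '' Icc y one') :=
      (preconn_Icc y).image _ (by fun_prop)
    have hsub : (fun c : II => ((a, c) : Strip)) '' Icc y one' ⊆ NN Up η := by
      rintro _ ⟨c, hc, rfl⟩
      refine ⟨huv ⟨hball ?_, hyv hc⟩, ?_⟩
      · rw [Metric.mem_ball, Real.dist_eq, abs_lt]
        have := min_le_left ε 1
        constructor <;> linarith [ha.1, ha.2]
      · rintro ⟨⟨m, hm⟩, -⟩
        have hm : (m : ℝ) = a := hm
        rw [← hm] at haj
        have h1 : j < m := by exact_mod_cast haj.1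
        have h2 : m < j + 1 := by exact_mod_cast haj.2
        omega
    have h1 : ((a, one') : Strip) ∈ WW Up η j := top_WW hX j haj
    have h2 := hpre.subset_connectedComponentIn (x := ((a, one') : Strip))
      ⟨one', ⟨y.2.2, le_rfl⟩, rfl⟩ hsub
    unfold WW at h1 ⊢
    rw [connectedComponentIn_eq h1]
    exact h2 ⟨b, ⟨hb, b.2.2⟩, rfl⟩
  have hm1 : min ε 1 ≤ 1 := min_le_right _ _
  refine ⟨min ε 1, by positivity, fun a b hb => ⟨fun ha => ?_, fun ha => ?_⟩⟩
  · exact key a ⟨by linarith [ha.1, ha.2], ha.2⟩ ha.1.ne' k ⟨ha.1, by linarith [ha.2]⟩ b hb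
  · refine key a ⟨ha.1, by linarith [ha.1, ha.2]⟩ ha.2.ne (k - 1) ⟨?_, ?_⟩ b hb
    · push_cast; linarith [ha.1]
    · push_cast; linarith [ha.2]

/-- The good set. -/
def GG (Up : Set Ann) (η : ℝ) : Set Strip :=
  {z | (∃ k, z ∈ WW Up η k) ∨ ((∃ k : ℤ, z.1 = k) ∧ η < (z.2 : ℝ))}

lemma isOpen_GG (hX : IsEAC X Um Up) (hη : etaSpec (pr ⁻¹' X) η) : IsOpen (GG Up η) := by
  have : LocallyConnectedSpace II := by
    have : LocallyPathConnectedSpace II := (convex_Icc (-1 : ℝ) 1).locallyPathConnectedSpace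
    infer_instance
  have : LocallyConnectedSpace Strip := inferInstance
  rw [isOpen_iff_mem_nhds]
  rintro ⟨a, y⟩ (⟨k, hk⟩ | ⟨⟨k, hk⟩, hy⟩)
  · have ho : IsOpen (WW Up η k) := (isOpen_NN hX).connectedComponentIn
    exact mem_of_superset (ho.mem_nhds hk) fun z hz => Or.inl ⟨k, hz⟩
  · simp only at hk hy
    subst hk
    obtain ⟨c, hc1, hc2⟩ := exists_between hy
    have hη1 := (eta_lt hX hη).1
    have hcI : c ∈ II := ⟨by linarith, by linarith [y.2.2]⟩
    obtain ⟨δ, hδ, hbox⟩ := box hX hη k ⟨c, hcI⟩ hc1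
    have hU : IsOpen {z : Strip | z.1 ∈ Ioo (k - δ : ℝ) (k + δ) ∧ c < (z.2 : ℝ)} := by
      refine (isOpen_Ioo.preimage continuous_fst).inter ?_
      exact isOpen_lt continuous_const (continuous_subtype_val.comp continuous_snd)
    refine mem_of_superset (hU.mem_nhds ⟨⟨by simp [hδ], by simp [hδ]⟩, hc2⟩) ?_
    rintro ⟨a, b⟩ ⟨ha, hb⟩
    simp only at ha hb
    rcases lt_trichotomy a k with h | h | h
    · exact Or.inl ⟨k - 1, (hbox a b hb.le).2 ⟨ha.1, h⟩⟩
    · exact Or.inr ⟨⟨k, h⟩, hc1.trans hb⟩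
    · exact Or.inl ⟨k, (hbox a b hb.le).1 ⟨h, ha.2⟩⟩

lemma shift_GG (j : ℤ) {z : Strip} (hz : z ∈ GG Up η) : shiftPt j z ∈ GG Up η := by
  rcases hz with ⟨k, hk⟩ | ⟨⟨k, hk⟩, hy⟩
  · exact Or.inl ⟨_, shift_mem_WW j k hk⟩
  · exact Or.inr ⟨⟨k + j, by simp [shiftPt, hk]⟩, hy⟩

/-- Off the translates of `β`, a point of `Ũ₊` is in `NN` iff ... -/
lemma not_Bbar (hX : IsEAC X Um Up) (hη : etaSpec (pr ⁻¹' X) η) {z : Strip}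
    (hz : z ∈ pr ⁻¹' Up) (hG : z ∉ GG Up η) : z ∈ NN Up η := by
  refine ⟨hz, ?_⟩
  rintro ⟨⟨k, hk⟩, hy⟩
  rcases hy.lt_or_eq with h | h
  · exact hG (Or.inr ⟨⟨k, hk.symm⟩, h⟩)
  · obtain ⟨w, hw, h1, h2⟩ := hη.1
    have : shiftPt k w = z := by
      unfold shiftPt
      ext1
      · simp [h1, hk]
      · exact Subtype.ext (by simp [h2, h])
    rw [← this, mem_preimage, pr_shiftPt] at hz
    exact Up_disj hX hz hw

lemma isOpen_bad (hX : IsEAC X Um Up) (hη : etaSpec (pr ⁻¹' X) η) :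
    IsOpen (pr ⁻¹' Up \ GG Up η) := by
  have : LocallyConnectedSpace II := by
    have : LocallyPathConnectedSpace II := (convex_Icc (-1 : ℝ) 1).locallyPathConnectedSpace
    infer_instance
  have : LocallyConnectedSpace Strip := inferInstance
  rw [isOpen_iff_mem_nhds]
  rintro z ⟨hz, hG⟩
  have hN := not_Bbar hX hη hz hG
  have ho : IsOpen (connectedComponentIn (NN Up η) z) := (isOpen_NN hX).connectedComponentIn
  refine mem_of_superset (ho.mem_nhds (mem_connectedComponentIn hN)) ?_
  intro w hw
  have hwN := connectedComponentIn_subset _ _ hw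
  refine ⟨hwN.1, ?_⟩
  rintro (⟨k, hk⟩ | ⟨⟨k, hk⟩, hy⟩)
  · apply hG
    left
    refine ⟨k, ?_⟩
    unfold WW at hk ⊢
    rw [connectedComponentIn_eq hk, ← connectedComponentIn_eq hw]
    exact mem_connectedComponentIn hN
  · exact hwN.2 ⟨⟨k, hk.symm⟩, hy.le⟩

lemma all_good (hX : IsEAC X Um Up) (hη : etaSpec (pr ⁻¹' X) η) :
    pr ⁻¹' Up ⊆ GG Up η := by
  intro z hz
  by_contra hG
  have hc : IsPreconnected Up := by
    rw [hX.hUp]; exact isPreconnected_connectedComponentIn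
  obtain ⟨p, -, ⟨a, ha, hap⟩, ⟨b, hb, hbp⟩⟩ := hc _ _
    (isOpenMap_pr _ (isOpen_GG hX hη)) (isOpenMap_pr _ (isOpen_bad hX hη)) (by
      intro p hp
      obtain ⟨a, ha⟩ := QuotientAddGroup.mk_surjective p.1
      have hap : pr (a, p.2) = p := by ext1; exacts [ha, rfl]
      by_cases h : ((a, p.2) : Strip) ∈ GG Up η
      · exact Or.inl ⟨_, h, hap⟩
      · exact Or.inr ⟨_, ⟨by rw [mem_preimage, hap]; exact hp, h⟩, hap⟩)
    (by
      refine ⟨pr ((1 : ℝ) / 2, one'), top_mem hX _, _, Or.inl ⟨0, ?_⟩, rfl⟩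
      exact top_WW hX 0 (by constructor <;> norm_num))
    ⟨pr z, hz, z, ⟨hz, hG⟩, rfl⟩
  obtain ⟨k, hk⟩ := pr_eq (hap.trans hbp.symm)
  exact hb.2 (hk ▸ shift_GG k ha)

lemma WW_sub (hX : IsEAC X Um Up) (k : ℤ) :
    WW Up η 0 ⊆ connectedComponentIn
      (pr ⁻¹' Up \ (betaP η ∪ shiftSet 1 (betaP η))) topSeg := by
  unfold WW
  rw [shift_zero]
  refine connectedComponentIn_mono _ ?_
  rintro z ⟨hz, hB⟩
  refine ⟨hz, ?_⟩
  rintro (⟨h1, h2⟩ | ⟨w, ⟨h1, h2⟩, rfl⟩)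
  · exact hB ⟨⟨0, by simp [h1]⟩, h2.le⟩
  · exact hB ⟨⟨1, by simp [shiftPt, h1]⟩, h2.le⟩

lemma WW_V (hX : IsEAC X Um Up) (k : ℤ) :
    WW Up η k ⊆ shiftSet k (Vset (pr ⁻¹' Up) η) := by
  intro z hz
  have h := shift_mem_WW (-k) k hz
  rw [add_neg_cancel] at h
  refine ⟨shiftPt (-k) z, ⟨(connectedComponentIn_subset _ _ h).1,
    subset_closure (WW_sub hX 0 h)⟩, ?_⟩
  rw [shift_shift, neg_add_cancel, shift_zero]

lemma beta_V (hX : IsEAC X Um Up) (hη : etaSpec (pr ⁻¹' X) η) (k : ℤ) (y : II)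
    (hy : η < y) : (((k : ℝ), y) : Strip) ∈ shiftSet k (Vset (pr ⁻¹' Up) η) := by
  refine ⟨((0 : ℝ), y), ⟨?_, ?_⟩, (int_shift k y).symm⟩
  · simpa using beta_mem hX hη 0 y hy
  · refine closure_mono (WW_sub hX 0) ?_
    obtain ⟨δ, hδ, hbox⟩ := box hX hη 0 y hy
    have hcl : (0 : ℝ) ∈ closure (Ioo (0 : ℝ) δ) := by
      rw [closure_Ioo hδ.ne]; exact ⟨le_rfl, hδ.le⟩
    refine map_mem_closure (f := fun a : ℝ => ((a, y) : Strip)) (by fun_prop) hcl ?_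
    intro a ha
    exact (hbox a y le_rfl).1 (by simpa using ha)

end main

end AccAux

open AccAux
/-- Lemma on prime ends, item 1: every point of `X̃` accessible from `Ũ₊`
is accessible from some translate `V + k` of the fundamental region. -/
theorem accessible_from_some_translate
    (X Um Up : Set Ann) (hX : IsEAC X Um Up)
    (η : ℝ) (hη : etaSpec (pr ⁻¹' X) η) :
    ∀ x ∈ pr ⁻¹' X, AccFrom (pr ⁻¹' Up) x →
      ∃ k : ℤ, AccFrom (shiftSet k (Vset (pr ⁻¹' Up) η)) x := by
  rintro x hx ⟨γ, hγc, hγi, hγU, hγ1⟩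
  have hη1 := eta_lt hX hη
  by_cases hB : x ∈ Bbar η
  · obtain ⟨⟨k, hk⟩, hy⟩ := hB
    have hxη : (x.2 : ℝ) = η := by
      refine le_antisymm (hη.2 ⟨((0 : ℝ), x.2), ?_, rfl, rfl⟩) hy
      have : shiftPt k ((0 : ℝ), x.2) = x := by
        rw [← int_shift, hk]
      rw [← this, mem_preimage, pr_shiftPt] at hx
      exact hx
    have hmem : ∀ t : unitInterval, (1 - t * (1 - η) : ℝ) ∈ II := by
      intro t
      have h0 := t.2.1
      have h1 := t.2.2
      constructor <;> nlinarith [hη1.1, hη1.2]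
    refine ⟨k, fun t => ((k : ℝ), ⟨1 - t * (1 - η), hmem t⟩), ?_, ?_, ?_, ?_⟩
    · fun_prop
    · intro s t hst
      simp only [Prod.mk.injEq, Subtype.mk.injEq, true_and] at hst
      have : (1 - η) ≠ 0 := by linarith [hη1.2]
      have h2 : (s : ℝ) * (1 - η) = t * (1 - η) := by linarith
      exact Subtype.ext (mul_right_cancel₀ this h2)
    · intro t ht
      have h1 : (t : ℝ) < 1 := lt_of_le_of_ne t.2.2 fun h => ht (Subtype.ext h)
      refine beta_V hX hη k _ ?_
      change η < 1 - t * (1 - η)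
      nlinarith [hη1.2]
    · ext1
      · exact hk
      · exact Subtype.ext (by simp [hxη])
  · have hnh : γ ⁻¹' (Bbar η)ᶜ ∈ 𝓝 (1 : unitInterval) :=
      hγc.continuousAt.preimage_mem_nhds
        ((isClosed_Bbar η).isOpen_compl.mem_nhds (by rw [hγ1]; exact hB))
    obtain ⟨s, hs1, hs⟩ := exists_Ioc_subset_of_mem_nhds hnh ⟨0, by
      exact zero_lt_one⟩
    obtain ⟨t₀, ht0, ht1⟩ := exists_between hs1
    have hsub : γ '' Ico t₀ 1 ⊆ NN Up η := by
      rintro _ ⟨t, ht, rfl⟩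
      exact ⟨hγU t ht.2.ne, hs ⟨ht0.trans_le ht.1, ht.2.le⟩⟩
    have hpre : IsPreconnected (γ '' Ico t₀ 1) :=
      (ordConnected_Ico).isPreconnected.image _ hγc.continuousOn
    have h0 : γ t₀ ∈ NN Up η := hsub ⟨t₀, ⟨le_rfl, ht1⟩, rfl⟩
    obtain ⟨k, hk⟩ : ∃ k, γ t₀ ∈ WW Up η k := by
      rcases all_good hX hη h0.1 with h | ⟨⟨k, hk⟩, hy⟩
      · exact h
      · exact absurd ⟨⟨k, hk.symm⟩, hy.le⟩ h0.2
    have hall : γ '' Ico t₀ 1 ⊆ WW Up η k := by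
      have := hpre.subset_connectedComponentIn ⟨t₀, ⟨le_rfl, ht1⟩, rfl⟩ hsub
      unfold WW at hk ⊢
      rwa [connectedComponentIn_eq hk]
    have ht1' : (t₀ : ℝ) < 1 := ht1
    have hmem : ∀ t : unitInterval, (t₀ + (1 - t₀) * t : ℝ) ∈ unitInterval := by
      intro t
      have h0 := t.2.1
      have h1 := t.2.2
      have h2 := t₀.2.1
      constructor <;> nlinarith
    refine ⟨k, fun t => γ ⟨t₀ + (1 - t₀) * t, hmem t⟩, ?_, ?_, ?_, ?_⟩
    · exact hγc.comp (by fun_prop)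
    · intro a b hab
      have h := hγi hab
      simp only [Subtype.mk.injEq] at h
      have hne : (1 - t₀ : ℝ) ≠ 0 := by linarith
      have h2 : (1 - t₀ : ℝ) * a = (1 - t₀) * b := by linarith
      exact Subtype.ext (mul_left_cancel₀ hne h2)
    · intro t ht
      have h1 : (t : ℝ) < 1 := lt_of_le_of_ne t.2.2 fun h => ht (Subtype.ext h)
      refine WW_V hX k (hall ⟨_, ⟨?_, ?_⟩, rfl⟩)
      · change (t₀ : ℝ) ≤ t₀ + (1 - t₀) * t
        have := t.2.1
        nlinarith
      · change (t₀ + (1 - t₀) * t : ℝ) < 1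
        nlinarith
    · rw [← hγ1]
      refine congrArg γ (Subtype.ext ?_)
      simp
end
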